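/- arXiv:2501.15422 — 2 statements merged into one kernel-verified Lean document; each statement's English description precedes it below -/
import Mathlib

section
/- Suppose n ≤ 4 and the domain D fails the top-two condition for O' = O. Then there exists a mechanism on D^N, different from TTC at some profile, that is individually rational, Pareto efficient, and strategyproof. -/
def top {α : Type*} (P : α → α → Prop) (O' : Set α) (a : α) : Prop :=
  a ∈ O' ∧ ∀ c ∈ O', c ≠ a → P a c

def topTwo {α : Type*} (D : Set (α → α → Prop)) : Prop :=
  ∀ O' : Set α, O'.Nonempty → ∀ a b : α, a ∈ O' → b ∈ O' → a ≠ b →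
    (∃ P ∈ D, top P O' a) → (∃ P ∈ D, top P O' b) →
      ∃ P0 ∈ D, top P0 O' a ∧ top P0 (O' \ {a}) b

/-! Housing market: agents and objects are both `Fin n`; agent i is endowed with
object i. A preference is a strict linear order on objects, modelled as a binary
relation (`P a b` means a is strictly preferred to b). -/

abbrev PrefRel (n : ℕ) := Fin n → Fin n → Prop

/-- A preference profile where agent i's preference must lie in the domain `Ds i`. -/
def Profile (n : ℕ) (Ds : Fin n → Set (PrefRel n)) : Type := {Pr : Fin n → PrefRel n // ∀ i, Pr i ∈ Ds i}

/-- Individual rationality: every agent weakly prefers their assignment to their endowment. -/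
def IR {n : ℕ} {Ds : Fin n → Set (PrefRel n)} (φ : Profile n Ds → Fin n → Fin n) : Prop :=
  ∀ P : Profile n Ds, ∀ i : Fin n, φ P i = i ∨ P.1 i (φ P i) i

/-- Strategyproofness: truth-telling is weakly dominant within the domain. -/
def SP {n : ℕ} {Ds : Fin n → Set (PrefRel n)} (φ : Profile n Ds → Fin n → Fin n) : Prop :=
  ∀ P Q : Profile n Ds, ∀ i : Fin n, (∀ j, j ≠ i → Q.1 j = P.1 j) →
    φ P i = φ Q i ∨ P.1 i (φ P i) (φ Q i)

/-- Pair efficiency: no two agents each strictly prefer the other's assignment. -/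
def PairEff {n : ℕ} {Ds : Fin n → Set (PrefRel n)} (φ : Profile n Ds → Fin n → Fin n) : Prop :=
  ∀ P : Profile n Ds, ∀ i j : Fin n, ¬ (P.1 i (φ P j) (φ P i) ∧ P.1 j (φ P i) (φ P j))

/-- Pareto efficiency: any allocation that weakly improves upon φ(P) for every agent
coincides with φ(P). -/
def ParetoEff {n : ℕ} {Ds : Fin n → Set (PrefRel n)} (φ : Profile n Ds → Fin n → Fin n) : Prop :=
  ∀ P : Profile n Ds, ∀ y : Fin n → Fin n, Function.Bijective y →
    (∀ i, y i = φ P i ∨ P.1 i (y i) (φ P i)) → ∀ i, y i = φ P i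

/-- `x` is the Top Trading Cycles allocation at the profile `Pr`: there is an assignment
of rounds `r` to agents (= objects, via endowment) such that each agent i receives their
most preferred object among objects whose owner is removed no earlier than i, and the
owner of the object i receives is removed in the same round as i. -/
def isTTC {n : ℕ} (Pr : Fin n → PrefRel n) (x : Fin n → Fin n) : Prop :=
  Function.Bijective x ∧ ∃ r : Fin n → ℕ, ∀ i : Fin n,
    r (x i) = r i ∧ ∀ o : Fin n, r i ≤ r o → o ≠ x i → Pr i (x i) o

/-- `D` fails the top-two condition for `O'`. -/
def failsTopTwoFor {α : Type*} (D : Set (α → α → Prop)) (O' : Set α) : Prop :=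
  ∃ a b : α, a ∈ O' ∧ b ∈ O' ∧ a ≠ b ∧
    (∃ P ∈ D, top P O' a) ∧ (∃ P ∈ D, top P O' b) ∧
    ∀ P ∈ D, top P O' a → ¬ top P (O' \ {a}) b

section TTC

variable {α : Type*}

open Classical in
/-- The `R`-greatest element of `S`, or `d` if there is none. -/
noncomputable def best (R : α → α → Prop) (S : Finset α) (d : α) : α :=
  if h : ∃ m ∈ S, ∀ c ∈ S, c ≠ m → R m c then h.choose else d

theorem exists_best {R : α → α → Prop} (hR : IsStrictTotalOrder α R) {S : Finset α}
    (hS : S.Nonempty) : ∃ m ∈ S, ∀ c ∈ S, c ≠ m → R m c := by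
  induction hS using Finset.Nonempty.cons_induction with
  | singleton a => exact ⟨a, by simp, by simp⟩
  | cons a s ha hs ih =>
    obtain ⟨m, hm, h⟩ := ih
    have hne : a ≠ m := fun e => ha (e ▸ hm)
    rcases trichotomous_of R a m with h1 | h1 | h1
    · refine ⟨a, by simp, fun c hc hca => ?_⟩
      by_cases hcm : c = m
      · exact hcm ▸ h1
      · exact _root_.trans h1 (h c (by simpa [hca] using hc) hcm)
    · exact absurd h1 hne
    · refine ⟨m, by simp [hm], fun c hc hcm => ?_⟩
      rcases Finset.mem_cons.1 hc with rfl | hc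
      · exact h1
      · exact h c hc hcm

theorem best_spec {R : α → α → Prop} (hR : IsStrictTotalOrder α R) {S : Finset α}
    (hS : S.Nonempty) (d : α) : best R S d ∈ S ∧ ∀ c ∈ S, c ≠ best R S d → R (best R S d) c := by
  have h := exists_best hR hS
  rw [best, dif_pos h]
  exact h.choose_spec

theorem best_eq {R : α → α → Prop} (hR : IsStrictTotalOrder α R) {S : Finset α} {m : α}
    (hm : m ∈ S) (h : ∀ c ∈ S, c ≠ m → R m c) (d : α) : best R S d = m := by
  obtain ⟨h1, h2⟩ := best_spec hR ⟨m, hm⟩ d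
  by_contra hne
  exact asymm (h2 m hm (Ne.symm hne)) (h _ h1 hne)

/-- The owner agent `i` points to when the agents (and objects) in `S` remain. -/
noncomputable def point (Pr : α → α → α → Prop) (S : Finset α) (i : α) : α :=
  best (Pr i) S i

open Classical in
/-- The agents that stay after all trading cycles among `S` have been executed. -/
noncomputable def rest (Pr : α → α → α → Prop) (S : Finset α) : Finset α :=
  S.filter (· ∉ Function.periodicPts (point Pr S))

open Classical in
/-- Top trading cycles among the agents in `S`. -/
noncomputable def ttc (Pr : α → α → α → Prop) (S : Finset α) (i : α) : α :=
  if _h : rest Pr S ⊂ S then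
    if i ∈ Function.periodicPts (point Pr S) then point Pr S i else ttc Pr (rest Pr S) i
  else i
termination_by S.card
decreasing_by exact Finset.card_lt_card _h

variable {Pr : α → α → α → Prop} {S : Finset α} {i : α}

theorem exists_mem_periodicPts [Finite α] (f : α → α) (x : α) :
    ∃ y, y ∈ Function.periodicPts f := by
  obtain ⟨m, k, hne, h⟩ := Finite.exists_ne_map_eq_of_infinite fun k : ℕ => f^[k] x
  wlog hlt : m < k generalizing m k
  · exact this k m hne.symm h.symm (by omega)
  refine ⟨f^[m] x, k - m, by omega, ?_⟩
  change f^[k - m] (f^[m] x) = f^[m] x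
  rw [← Function.iterate_add_apply, Nat.sub_add_cancel hlt.le]
  exact h.symm

theorem point_mem (hP : ∀ i, IsStrictTotalOrder α (Pr i)) (hS : S.Nonempty) (i : α) :
    point Pr S i ∈ S := (best_spec (hP i) hS i).1

theorem point_spec (hP : ∀ i, IsStrictTotalOrder α (Pr i)) {c : α} (hc : c ∈ S) :
    point Pr S i = c ∨ Pr i (point Pr S i) c := by
  by_cases h : c = point Pr S i
  · exact .inl h.symm
  · exact .inr ((best_spec (hP i) ⟨c, hc⟩ i).2 c hc h)

theorem mem_of_mem_periodicPts (hP : ∀ i, IsStrictTotalOrder α (Pr i)) (hS : S.Nonempty)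
    (hi : i ∈ Function.periodicPts (point Pr S)) : i ∈ S := by
  obtain ⟨j, -, rfl⟩ := (Function.bijOn_periodicPts (point Pr S)).surjOn hi
  exact point_mem hP hS j

theorem mem_rest : i ∈ rest Pr S ↔ i ∈ S ∧ i ∉ Function.periodicPts (point Pr S) := by
  simp [rest]

theorem rest_ssubset [Finite α] (hP : ∀ i, IsStrictTotalOrder α (Pr i)) (hS : S.Nonempty) :
    rest Pr S ⊂ S := by
  obtain ⟨x, -⟩ := id hS
  obtain ⟨y, hy⟩ := exists_mem_periodicPts (point Pr S) x
  exact ⟨fun z hz => (mem_rest.1 hz).1, fun h =>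
    (mem_rest.1 (h (mem_of_mem_periodicPts hP hS hy))).2 hy⟩

theorem ttc_of_mem [Finite α] (hP : ∀ i, IsStrictTotalOrder α (Pr i)) (hS : S.Nonempty)
    (hi : i ∈ Function.periodicPts (point Pr S)) : ttc Pr S i = point Pr S i := by
  rw [ttc, dif_pos (rest_ssubset hP hS), if_pos hi]

theorem ttc_of_notMem [Finite α] (hP : ∀ i, IsStrictTotalOrder α (Pr i)) (hS : S.Nonempty)
    (hi : i ∉ Function.periodicPts (point Pr S)) : ttc Pr S i = ttc Pr (rest Pr S) i := by
  rw [ttc, dif_pos (rest_ssubset hP hS), if_neg hi]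

theorem ttc_mem [Finite α] (hP : ∀ i, IsStrictTotalOrder α (Pr i)) (hi : i ∈ S) :
    ttc Pr S i ∈ S := by
  induction S using Finset.strongInduction with
  | H S ih =>
    have hS : S.Nonempty := ⟨i, hi⟩
    by_cases hp : i ∈ Function.periodicPts (point Pr S)
    · rw [ttc_of_mem hP hS hp]
      exact point_mem hP hS i
    · rw [ttc_of_notMem hP hS hp]
      exact (mem_rest.1 (ih _ (rest_ssubset hP hS) (mem_rest.2 ⟨hi, hp⟩))).1

theorem ttc_injOn [Finite α] (hP : ∀ i, IsStrictTotalOrder α (Pr i)) :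
    Set.InjOn (ttc Pr S) S := by
  induction S using Finset.strongInduction with
  | H S ih =>
    have key : ∀ i ∈ S, ∀ j ∈ S, i ∈ Function.periodicPts (point Pr S) →
        j ∉ Function.periodicPts (point Pr S) → ttc Pr S i ≠ ttc Pr S j := by
      intro i hi j hj hpi hpj h
      have hS : S.Nonempty := ⟨i, hi⟩
      rw [ttc_of_mem hP hS hpi, ttc_of_notMem hP hS hpj] at h
      exact (mem_rest.1 (ttc_mem hP (mem_rest.2 ⟨hj, hpj⟩))).2
        (h ▸ (Function.bijOn_periodicPts (point Pr S)).mapsTo hpi)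
    intro i hi j hj h
    have hS : S.Nonempty := ⟨i, hi⟩
    by_cases hpi : i ∈ Function.periodicPts (point Pr S) <;>
      by_cases hpj : j ∈ Function.periodicPts (point Pr S)
    · rw [ttc_of_mem hP hS hpi, ttc_of_mem hP hS hpj] at h
      exact (Function.bijOn_periodicPts (point Pr S)).injOn hpi hpj h
    · exact absurd h (key i hi j hj hpi hpj)
    · exact absurd h.symm (key j hj i hi hpj hpi)
    · rw [ttc_of_notMem hP hS hpi, ttc_of_notMem hP hS hpj] at h
      exact ih _ (rest_ssubset hP hS) (mem_rest.2 ⟨hi, hpi⟩) (mem_rest.2 ⟨hj, hpj⟩) h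

/-- No assignment of the objects in `S` to their owners dominates top trading cycles. -/
theorem ttc_paretoEff [Finite α] (hP : ∀ i, IsStrictTotalOrder α (Pr i)) {y : α → α}
    (hy : Set.InjOn y S) (hyS : ∀ i ∈ S, y i ∈ S)
    (h : ∀ i ∈ S, y i = ttc Pr S i ∨ Pr i (y i) (ttc Pr S i)) :
    ∀ i ∈ S, y i = ttc Pr S i := by
  induction S using Finset.strongInduction with
  | H S ih =>
    intro i hi
    have hS : S.Nonempty := ⟨i, hi⟩
    have hper : ∀ j ∈ Function.periodicPts (point Pr S), y j = point Pr S j := by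
      intro j hj
      have hjS := mem_of_mem_periodicPts hP hS hj
      have h1 := h j hjS
      rw [ttc_of_mem hP hS hj] at h1
      have := hP j
      rcases h1 with h1 | h1
      · exact h1
      · rcases point_spec (i := j) hP (hyS j hjS) with h2 | h2
        · exact h2.symm
        · exact absurd h2 (asymm h1)
    by_cases hp : i ∈ Function.periodicPts (point Pr S)
    · rw [ttc_of_mem hP hS hp, hper i hp]
    · rw [ttc_of_notMem hP hS hp]
      refine ih _ (rest_ssubset hP hS) (hy.mono fun j hj => (mem_rest.1 hj).1) ?_ ?_ i
        (mem_rest.2 ⟨hi, hp⟩)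
      · intro j hj
        obtain ⟨hjS, hjp⟩ := mem_rest.1 hj
        refine mem_rest.2 ⟨hyS j hjS, fun hyj => hjp ?_⟩
        obtain ⟨k, hk, hkj⟩ := (Function.bijOn_periodicPts (point Pr S)).surjOn hyj
        rw [← hper k hk] at hkj
        exact hy (mem_of_mem_periodicPts hP hS hk) hjS hkj ▸ hk
      · intro j hj
        obtain ⟨hjS, hjp⟩ := mem_rest.1 hj
        rw [← ttc_of_notMem hP hS hjp]
        exact h j hjS

/-- `x` is not `i` and points to `y` when the agents in `S` remain. -/
def PointsAway (Pr : α → α → α → Prop) (S : Finset α) (i x y : α) : Prop :=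
  x ≠ i ∧ point Pr S x = y

/-- Anything whose owner points (indirectly) to `i` is available to `i`. -/
theorem ttc_ge_of_chain [Finite α] (hP : ∀ i, IsStrictTotalOrder α (Pr i)) (hi : i ∈ S) {o : α}
    (ho : o ∈ S) (hc : Relation.ReflTransGen (PointsAway Pr S i) o i) :
    ttc Pr S i = o ∨ Pr i (ttc Pr S i) o := by
  induction S using Finset.strongInduction with
  | H S ih =>
    have hS : S.Nonempty := ⟨i, hi⟩
    by_cases hp : i ∈ Function.periodicPts (point Pr S)
    · rw [ttc_of_mem hP hS hp]
      exact point_spec hP ho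
    · rw [ttc_of_notMem hP hS hp]
      have key : o ∈ rest Pr S ∧
          Relation.ReflTransGen (PointsAway Pr (rest Pr S) i) o i := by
        clear ih
        induction hc using Relation.ReflTransGen.head_induction_on with
        | refl => exact ⟨mem_rest.2 ⟨hi, hp⟩, .refl⟩
        | @head x z hxz _ ih2 =>
          obtain ⟨hz, hzi⟩ := ih2 (hxz.2 ▸ point_mem hP hS x)
          obtain ⟨hzS, hzp⟩ := mem_rest.1 hz
          refine ⟨mem_rest.2 ⟨ho, fun hx => hzp ?_⟩, .head ⟨hxz.1, ?_⟩ hzi⟩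
          · exact hxz.2 ▸ (Function.bijOn_periodicPts (point Pr S)).mapsTo hx
          · refine best_eq (hP x) hz (fun c hc hcz => ?_) x
            rcases point_spec (i := x) hP (mem_rest.1 hc).1 with h | h
            · exact absurd (h.symm.trans hxz.2) hcz
            · exact hxz.2 ▸ h
      exact ih _ (rest_ssubset hP hS) (mem_rest.2 ⟨hi, hp⟩) key.1 key.2

theorem ttc_ge_self [Finite α] (hP : ∀ i, IsStrictTotalOrder α (Pr i)) (hi : i ∈ S) :
    ttc Pr S i = i ∨ Pr i (ttc Pr S i) i := ttc_ge_of_chain hP hi hi .refl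

/-- If `i` is on a cycle, the object `i` points to leads back to `i`. -/
theorem chain_of_mem_periodicPts (hi : i ∈ Function.periodicPts (point Pr S)) :
    Relation.ReflTransGen (PointsAway Pr S i) (point Pr S i) i := by
  have key : ∀ k x, (point Pr S)^[k] x = i → Relation.ReflTransGen (PointsAway Pr S i) x i := by
    intro k
    induction k with
    | zero => exact fun x hx => hx ▸ .refl
    | succ k ih =>
      intro x hki
      by_cases hx : x = i
      · exact hx ▸ .refl
      · exact .head ⟨hx, rfl⟩ (ih _ hki)
  obtain ⟨k, hk, hki⟩ := hi
  refine key (k - 1) _ ?_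
  rwa [← Function.iterate_succ_apply, Nat.succ_eq_add_one, Nat.sub_add_cancel hk]

theorem mem_periodicPts_of_agree {Q : α → α → α → Prop} (hPQ : ∀ j, j ≠ i → Q j = Pr j)
    (hi : i ∉ Function.periodicPts (point Pr S)) {x : α}
    (hx : x ∈ Function.periodicPts (point Pr S)) : x ∈ Function.periodicPts (point Q S) := by
  obtain ⟨k, hk, hkx⟩ := hx
  refine ⟨k, hk, ?_⟩
  have key : ∀ m, (point Q S)^[m] x = (point Pr S)^[m] x := by
    intro m
    induction m with
    | zero => rfl
    | succ m ih =>
      rw [Function.iterate_succ_apply', Function.iterate_succ_apply', ih]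
      have hne : (point Pr S)^[m] x ≠ i := by
        rintro rfl
        exact hi ⟨k, hk, hkx.apply_iterate m⟩
      rw [point, hPQ _ hne, point]
  exact (key k).trans hkx

theorem ttc_strategyproof [Finite α] {Q : α → α → α → Prop}
    (hP : ∀ i, IsStrictTotalOrder α (Pr i)) (hQ : ∀ i, IsStrictTotalOrder α (Q i))
    (hPQ : ∀ j, j ≠ i → Q j = Pr j) (hi : i ∈ S) :
    ttc Pr S i = ttc Q S i ∨ Pr i (ttc Pr S i) (ttc Q S i) := by
  induction S using Finset.strongInduction with
  | H S ih =>
    have hS : S.Nonempty := ⟨i, hi⟩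
    by_cases hp : i ∈ Function.periodicPts (point Pr S)
    · rw [ttc_of_mem hP hS hp]
      exact point_spec hP (ttc_mem hQ hi)
    by_cases hq : i ∈ Function.periodicPts (point Q S)
    · rw [ttc_of_mem hQ hS hq]
      refine ttc_ge_of_chain hP hi (point_mem hQ hS i)
        (Relation.ReflTransGen.mono (fun x y h => ⟨h.1, ?_⟩) _ _ (chain_of_mem_periodicPts hq))
      rw [← h.2, point, point, hPQ x h.1]
    · have hr : rest Pr S = rest Q S := by
        ext x
        rw [mem_rest, mem_rest]
        exact and_congr_right fun _ => not_congr
          ⟨mem_periodicPts_of_agree hPQ hp,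
            mem_periodicPts_of_agree (fun j hj => (hPQ j hj).symm) hq⟩
      rw [ttc_of_notMem hP hS hp, ttc_of_notMem hQ hS hq, ← hr]
      exact ih _ (rest_ssubset hP hS) (mem_rest.2 ⟨hi, hp⟩)

end TTC

/-- There are at most four agents: `a`, `b`, `d` and possibly a fourth one `c`
(with `c = d` if there are only three). -/
structure Setting {α : Type*} (a b c d : α) : Prop where
  hab : a ≠ b
  had : a ≠ d
  hbd : b ≠ d
  hca : c ≠ a
  hcb : c ≠ b
  hcov : ∀ x, x = a ∨ x = b ∨ x = c ∨ x = d

/-- Agents `a` and `b` top-rank each other's endowment, agent `c` prefers the endowment of `d`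
to their own, and agent `d` ranks the endowment of `a` above everything but that of `b`. -/
def Modified {α : Type*} (a b c d : α) (Pr : α → α → α → Prop) : Prop :=
  (∀ x, x ≠ b → Pr a b x) ∧ (∀ x, x ≠ a → Pr b a x) ∧ (c ≠ d → Pr c d c) ∧
    ∀ x, x ≠ a → x ≠ b → Pr d a x

section Complete

variable {α : Type*} [Fintype α] {a b c d : α} {Pr : α → α → α → Prop}

theorem point_univ_eq (hP : ∀ i, IsStrictTotalOrder α (Pr i)) {i m : α}
    (h : ∀ x, x ≠ m → Pr i m x) : point Pr Finset.univ i = m :=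
  best_eq (hP i) (Finset.mem_univ m) (fun x _ => h x) i

theorem ttc_univ_injective (hP : ∀ i, IsStrictTotalOrder α (Pr i)) :
    Function.Injective (ttc Pr Finset.univ) := by
  simpa [Set.injOn_univ] using ttc_injOn (S := Finset.univ) hP

theorem ttc_of_mutual (hP : ∀ i, IsStrictTotalOrder α (Pr i)) (ha : ∀ x, x ≠ b → Pr a b x)
    (hb : ∀ x, x ≠ a → Pr b a x) :
    ttc Pr Finset.univ a = b ∧ ttc Pr Finset.univ b = a := by
  have h1 := point_univ_eq hP ha
  have h2 := point_univ_eq hP hb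
  have hne : (Finset.univ : Finset α).Nonempty := ⟨a, Finset.mem_univ a⟩
  refine ⟨?_, ?_⟩
  · rw [ttc_of_mem hP hne ⟨2, by simp, ?_⟩, h1]
    change point Pr _ (point Pr _ a) = a
    rw [h1, h2]
  · rw [ttc_of_mem hP hne ⟨2, by simp, ?_⟩, h2]
    change point Pr _ (point Pr _ b) = b
    rw [h2, h1]

/-- If `a` top-ranks `b`, `d` ranks only `b` above `a`, `c` does not top-rank their own endowment
and `b` does not top-rank `a`, then `b` receives their favourite object. -/
theorem ttc_eq_point_of_modified (hcov : ∀ x, x = a ∨ x = b ∨ x = c ∨ x = d)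
    (hP : ∀ i, IsStrictTotalOrder α (Pr i)) (ha : ∀ x, x ≠ b → Pr a b x)
    (hc : c ≠ d → Pr c d c) (hd : ∀ x, x ≠ a → x ≠ b → Pr d a x)
    (hb : point Pr Finset.univ b ≠ a) :
    ttc Pr Finset.univ b = point Pr Finset.univ b := by
  have hfa := point_univ_eq hP ha
  have hne : (Finset.univ : Finset α).Nonempty := ⟨a, Finset.mem_univ a⟩
  have hfd : point Pr Finset.univ d = a ∨ point Pr Finset.univ d = b := by
    by_contra! h
    have := hP d
    rcases point_spec (i := d) hP (Finset.mem_univ a) with h1 | h1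
    · exact h.1 h1
    · exact asymm h1 (hd _ h.1 h.2)
  have hfc : c ≠ d → point Pr Finset.univ c ≠ c := by
    intro hcd h
    have := hP c
    rcases point_spec (i := c) hP (Finset.mem_univ d) with h1 | h1
    · exact hcd (h.symm.trans h1)
    · rw [h] at h1
      exact asymm h1 (hc hcd)
  refine ttc_of_mem hP hne ?_
  generalize point Pr Finset.univ = f at *
  have h4 : f b = b ∨ f (f b) = b ∨ f (f (f b)) = b ∨ f (f (f (f b))) = b ∨
      f (f (f (f (f b)))) = b := by
    have h1 := hcov (f b)
    have h2 := hcov (f c)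
    grind
  rcases h4 with h | h | h | h | h
  exacts [⟨1, by simp, h⟩, ⟨2, by simp, h⟩, ⟨3, by simp, h⟩, ⟨4, by simp, h⟩, ⟨5, by simp, h⟩]

end Complete

section Rotate

variable {α : Type*} [DecidableEq α] {a b c d s : α}

/-- The allocation `a ↦ b ↦ s ↦ d ↦ a`, where possibly `s = d`. -/
def rotate (a b d s i : α) : α :=
  if i = a then b else if i = b then s else if i = d then a else if i = s then d else i

theorem rotate_injective (hab : a ≠ b) (had : a ≠ d) (hbd : b ≠ d) (hsa : s ≠ a) (hsb : s ≠ b) :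
    Function.Injective (rotate a b d s) := by
  intro i j h
  unfold rotate at h
  split_ifs at h <;> grind

/-- The values of `rotate` at the four agents. -/
theorem rotate_values (H : Setting a b c d) (hsa : s ≠ a) (hsb : s ≠ b) :
    rotate a b d s a = b ∧ rotate a b d s b = s ∧ rotate a b d s d = a ∧
      (c ≠ d → s = c ∧ rotate a b d s c = d ∨ s = d ∧ rotate a b d s c = c) := by
  obtain ⟨hab, had, hbd, hca, hcb, hcov⟩ := H
  have := hcov s
  unfold rotate
  grind

end Rotate

theorem eq_or_rel_of_top {α : Type*} {R : α → α → Prop} {m : α} (h : ∀ x, x ≠ m → R m x) (x : α) :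
    m = x ∨ R m x :=
  (eq_or_ne x m).imp Eq.symm (h x)

section Mechanism

variable {α : Type*} [Fintype α] [DecidableEq α]

/-- The favourite object of agent `b` other than `a`. -/
noncomputable def second (a b : α) (Pr : α → α → α → Prop) : α :=
  best (Pr b) (Finset.univ.erase a) b

open Classical in
/-- Top trading cycles, except that on `Modified` profiles agent `d` receives `a`
and agent `b` the second most preferred object. -/
noncomputable def mechanism (a b c d : α) (Pr : α → α → α → Prop) (i : α) : α :=
  if Modified a b c d Pr then rotate a b d (second a b Pr) i else ttc Pr Finset.univ i

variable {a b c d : α} {Pr Q : α → α → α → Prop}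

theorem second_spec (hP : ∀ i, IsStrictTotalOrder α (Pr i)) (hab : a ≠ b) :
    second a b Pr ≠ a ∧ ∀ x, x ≠ a → x ≠ second a b Pr → Pr b (second a b Pr) x := by
  obtain ⟨h1, h2⟩ := best_spec (S := Finset.univ.erase a) (hP b) ⟨b, by simp [hab.symm]⟩ b
  exact ⟨(Finset.mem_erase.1 h1).1, fun x hx => h2 x (by simp [hx])⟩

/-- On a two-agent remainder, an agent receives the other's endowment if both want to swap. -/
theorem ttc_eq_of_swap (hP : ∀ i, IsStrictTotalOrder α (Pr i))
    (hc : Pr c d c) (hd : Pr d c d) (hcd : ttc Pr Finset.univ c = c) :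
    ttc Pr Finset.univ d ≠ d := by
  intro hdd
  have hne : c ≠ d := by
    rintro rfl
    have := hP c
    exact irrefl c hc
  have hinj := ttc_univ_injective hP
  have h := ttc_paretoEff (S := Finset.univ) (y := ttc Pr Finset.univ ∘ Equiv.swap c d) hP
    (by simpa [Set.injOn_univ] using hinj.comp (Equiv.swap c d).injective) (by simp) ?_ c
    (Finset.mem_univ c)
  · simp [hcd, hdd] at h
    exact hne h.symm
  · intro i _
    by_cases hi : i = c
    · subst hi
      exact .inr (by simpa [hcd, hdd] using hc)
    by_cases hi' : i = d
    · subst hi'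
      exact .inr (by simpa [hcd, hdd] using hd)
    · exact .inl (by simp [Equiv.swap_apply_of_ne_of_ne hi hi'])

theorem mechanism_of_modified (h : Modified a b c d Pr) (i : α) :
    mechanism a b c d Pr i = rotate a b d (second a b Pr) i := if_pos h

theorem mechanism_of_not_modified (h : ¬ Modified a b c d Pr) (i : α) :
    mechanism a b c d Pr i = ttc Pr Finset.univ i := if_neg h

theorem mechanism_injective (H : Setting a b c d) (hP : ∀ i, IsStrictTotalOrder α (Pr i))
    (hs : (∀ x, x ≠ a → Pr b a x) → second a b Pr ≠ b) :
    Function.Injective (mechanism a b c d Pr) := by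
  by_cases h : Modified a b c d Pr
  · rw [funext (mechanism_of_modified h)]
    exact rotate_injective H.hab H.had H.hbd (second_spec hP H.hab).1 (hs h.2.1)
  · rw [funext (mechanism_of_not_modified h)]
    exact ttc_univ_injective hP

theorem mechanism_individuallyRational (H : Setting a b c d)
    (hP : ∀ i, IsStrictTotalOrder α (Pr i))
    (hs : (∀ x, x ≠ a → Pr b a x) → second a b Pr ≠ b) (i : α) :
    mechanism a b c d Pr i = i ∨ Pr i (mechanism a b c d Pr i) i := by
  by_cases h : Modified a b c d Pr
  · rw [mechanism_of_modified h]
    obtain ⟨hsa, hs'⟩ := second_spec hP H.hab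
    have hsb := hs h.2.1
    obtain ⟨ra, rb, rd, rc⟩ := rotate_values H hsa hsb
    obtain ⟨h1, h2, h3, h4⟩ := h
    rcases eq_or_ne i d with rfl | hid
    · rw [rd]
      exact .inr (h4 _ H.had.symm H.hbd.symm)
    rcases H.hcov i with rfl | rfl | rfl | rfl
    · rw [ra]
      exact .inr (h1 _ H.hab)
    · rw [rb]
      exact .inr (hs' _ H.hab.symm hsb.symm)
    · rcases rc hid with ⟨-, e⟩ | ⟨-, e⟩
      · exact .inr (e.symm ▸ h3 hid)
      · exact .inl e
    · exact absurd rfl hid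
  · rw [mechanism_of_not_modified h]
    exact ttc_ge_self hP (Finset.mem_univ i)

theorem mechanism_paretoEff (H : Setting a b c d) (hP : ∀ i, IsStrictTotalOrder α (Pr i))
    (hs : (∀ x, x ≠ a → Pr b a x) → second a b Pr ≠ b) {y : α → α} (hy : Function.Injective y)
    (hge : ∀ i, y i = mechanism a b c d Pr i ∨ Pr i (y i) (mechanism a b c d Pr i)) (i : α) :
    y i = mechanism a b c d Pr i := by
  have hinj := mechanism_injective H hP hs
  by_cases h : Modified a b c d Pr
  · rw [funext (mechanism_of_modified h)] at *
    obtain ⟨hsa, hs'⟩ := second_spec hP H.hab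
    have hsb := hs h.2.1
    obtain ⟨ra, rb, rd, rc⟩ := rotate_values H hsa hsb
    obtain ⟨h1, h2, h3, h4⟩ := h
    have ya : y a = b := by
      have := hP a
      by_contra hne
      rcases hge a with e | e
      · exact hne (e.trans ra)
      · exact asymm (ra ▸ e) (h1 _ hne)
    have yd : y d = a := by
      have := hP d
      by_contra hne
      rcases hge d with e | e
      · exact hne (e.trans rd)
      · exact asymm (rd ▸ e) (h4 _ hne fun e' => H.had (hy (ya.trans e'.symm)))
    have yb : y b = second a b Pr := by
      have := hP b
      by_contra hne
      rcases hge b with e | e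
      · exact hne (e.trans rb)
      · exact asymm (rb ▸ e) (hs' _ (fun e' => H.hbd (hy (e'.trans yd.symm))) hne)
    rcases eq_or_ne i d with rfl | hid
    · rw [yd, rd]
    rcases H.hcov i with rfl | rfl | rfl | rfl
    · rw [ya, ra]
    · rw [yb, rb]
    · obtain ⟨j, hj⟩ := (Finite.injective_iff_surjective.1 hinj) (y i)
      rcases eq_or_ne j d with rfl | hjd
      · exact absurd (hy (yd.trans (rd.symm.trans hj))).symm hid
      rcases H.hcov j with rfl | rfl | rfl | rfl
      · exact absurd (hy (ya.trans (ra.symm.trans hj))).symm H.hca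
      · exact absurd (hy (yb.trans (rb.symm.trans hj))).symm H.hcb
      · exact hj.symm
      · exact absurd rfl hjd
    · exact absurd rfl hid
  · rw [funext (mechanism_of_not_modified h)] at *
    exact ttc_paretoEff (S := Finset.univ) hP hy.injOn (by simp) (fun i _ => hge i) i
      (Finset.mem_univ i)

theorem mechanism_strategyproof (H : Setting a b c d) (hP : ∀ i, IsStrictTotalOrder α (Pr i))
    (hQ : ∀ i, IsStrictTotalOrder α (Q i))
    (hs : (∀ x, x ≠ a → Pr b a x) → second a b Pr ≠ b)
    (hs' : (∀ x, x ≠ a → Q b a x) → second a b Q ≠ b) {i : α}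
    (hPQ : ∀ j, j ≠ i → Q j = Pr j) :
    mechanism a b c d Pr i = mechanism a b c d Q i ∨
      Pr i (mechanism a b c d Pr i) (mechanism a b c d Q i) := by
  have hPi := hP i
  by_cases hp : Modified a b c d Pr <;> by_cases hq : Modified a b c d Q
  · rw [mechanism_of_modified hp, mechanism_of_modified hq]
    obtain ⟨hsa, hss⟩ := second_spec hP H.hab
    rcases eq_or_ne i b with rfl | hib
    · rw [(rotate_values H hsa (hs hp.2.1)).2.1,
        (rotate_values H (second_spec hQ H.hab).1 (hs' hq.2.1)).2.1]
      exact (eq_or_ne _ _).imp Eq.symm (hss _ (second_spec hQ H.hab).1)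
    · rw [second, second, hPQ b hib.symm]
      exact .inl rfl
  · rw [mechanism_of_modified hp, mechanism_of_not_modified hq]
    obtain ⟨hsa, hss⟩ := second_spec hP H.hab
    obtain ⟨ra, rb, rd, rc⟩ := rotate_values H hsa (hs hp.2.1)
    obtain ⟨h1, h2, h3, h4⟩ := hp
    rcases eq_or_ne i d with rfl | hid
    · rw [← hPQ a H.had] at h1
      rw [← hPQ b H.hbd] at h2
      rw [rd]
      refine (eq_or_ne _ _).imp Eq.symm fun hne => h4 _ hne fun e => H.had ?_
      exact ttc_univ_injective hQ ((ttc_of_mutual hQ h1 h2).1.trans e.symm)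
    rcases H.hcov i with rfl | rfl | rfl | rfl
    · rw [ra]
      exact eq_or_rel_of_top h1 _
    · rw [← hPQ a H.hab] at h1
      rw [← hPQ c H.hcb] at h3
      rw [← hPQ d H.hbd.symm] at h4
      have hb : point Q Finset.univ i ≠ a := by
        intro e
        refine hq ⟨h1, fun x hx => ?_, h3, h4⟩
        rcases point_spec (i := i) hQ (Finset.mem_univ x) with h | h
        · exact absurd (h.symm.trans e) hx
        · exact e ▸ h
      rw [rb, ttc_eq_point_of_modified H.hcov hQ h1 h3 h4 hb]
      exact (eq_or_ne _ _).imp Eq.symm (hss _ hb)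
    · rw [← hPQ a H.hca.symm] at h1
      rw [← hPQ b H.hcb.symm] at h2
      rw [← hPQ d hid.symm] at h4
      obtain ⟨ta, tb⟩ := ttc_of_mutual hQ h1 h2
      have hinj := ttc_univ_injective hQ
      have hc : ttc Q Finset.univ i = i := by
        have := hQ i
        rcases ttc_ge_self hQ (Finset.mem_univ i) with h | h
        · exact h
        · rcases H.hcov (ttc Q Finset.univ i) with e | e | e | e
          · exact absurd (hinj (e.trans tb.symm)) H.hcb
          · exact absurd (hinj (e.trans ta.symm)) H.hca
          · exact e
          · exact absurd ⟨h1, h2, fun _ => e ▸ h, h4⟩ hq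
      rw [hc]
      rcases rc hid with ⟨-, e⟩ | ⟨-, e⟩
      · exact .inr (e.symm ▸ h3 hid)
      · exact .inl e
    · exact absurd rfl hid
  · rw [mechanism_of_not_modified hp, mechanism_of_modified hq]
    obtain ⟨hsa, hss⟩ := second_spec hQ H.hab
    obtain ⟨ra, rb, rd, rc⟩ := rotate_values H hsa (hs' hq.2.1)
    obtain ⟨h1, h2, h3, h4⟩ := hq
    rcases eq_or_ne i d with rfl | hid
    · rw [hPQ a H.had] at h1
      rw [hPQ b H.hbd] at h2
      obtain ⟨ta, tb⟩ := ttc_of_mutual hP h1 h2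
      have hinj := ttc_univ_injective hP
      have hIR := ttc_ge_self hP (Finset.mem_univ i)
      rw [rd]
      rcases trichotomous_of (Pr i) i a with e | e | e
      · rcases hIR with h | h
        · exact .inr (h.symm ▸ e)
        · exact .inr (_root_.trans h e)
      · exact absurd e.symm H.had
      · have hci : c ≠ i := by
          rintro rfl
          refine hp ⟨h1, h2, fun h => absurd rfl h, fun x hxa hxb => ?_⟩
          rcases H.hcov x with rfl | rfl | rfl | rfl
          exacts [absurd rfl hxa, absurd rfl hxb, e, e]
        rw [hPQ c hci] at h3
        have hca : Pr i c a := by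
          rcases trichotomous_of (Pr i) c a with h | h | h
          · exact h
          · exact absurd h H.hca
          · refine absurd ⟨h1, h2, h3, fun x hxa hxb => ?_⟩ hp
            rcases H.hcov x with rfl | rfl | rfl | rfl
            exacts [absurd rfl hxa, absurd rfl hxb, h, e]
        have hcd := _root_.trans hca e
        rcases H.hcov (ttc Pr Finset.univ i) with h | h | h | h
        · exact absurd (hinj (h.trans tb.symm)) H.hbd.symm
        · exact absurd (hinj (h.trans ta.symm)) H.had.symm
        · exact .inr (h.symm ▸ hca)
        · refine absurd h (ttc_eq_of_swap hP (h3 hci) hcd ?_)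
          rcases H.hcov (ttc Pr Finset.univ c) with h' | h' | h' | h'
          · exact absurd (hinj (h'.trans tb.symm)) H.hcb
          · exact absurd (hinj (h'.trans ta.symm)) H.hca
          · exact h'
          · exact absurd (hinj (h'.trans h.symm)) hci
    rcases H.hcov i with rfl | rfl | rfl | rfl
    · rw [hPQ b H.hab.symm] at h2
      rw [ra]
      exact ttc_ge_of_chain hP (Finset.mem_univ _) (Finset.mem_univ _)
        (.single ⟨H.hab.symm, point_univ_eq hP h2⟩)
    · rw [hPQ a H.hab] at h1
      rw [hPQ c H.hcb] at h3
      rw [hPQ d H.hbd.symm] at h4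
      have hb : point Pr Finset.univ i ≠ a := by
        intro e
        refine hp ⟨h1, fun x hx => ?_, h3, h4⟩
        rcases point_spec (i := i) hP (Finset.mem_univ x) with h | h
        · exact absurd (h.symm.trans e) hx
        · exact e ▸ h
      rw [rb, ttc_eq_point_of_modified H.hcov hP h1 h3 h4 hb]
      exact point_spec hP (Finset.mem_univ _)
    · rcases rc hid with ⟨-, e⟩ | ⟨-, e⟩
      · rw [hPQ a H.hca.symm] at h1
        rw [hPQ b H.hcb.symm] at h2
        rw [hPQ d hid.symm] at h4
        have hcd : Pr i i d := by
          rcases trichotomous_of (Pr i) i d with h | h | h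
          · exact h
          · exact absurd h hid
          · exact absurd ⟨h1, h2, fun _ => h, h4⟩ hp
        rw [e]
        rcases ttc_ge_self hP (Finset.mem_univ i) with h | h
        · exact .inr (h.symm ▸ hcd)
        · exact .inr (_root_.trans h hcd)
      · rw [e]
        exact ttc_ge_self hP (Finset.mem_univ i)
    · exact absurd rfl hid
  · rw [mechanism_of_not_modified hp, mechanism_of_not_modified hq]
    exact ttc_strategyproof hP hQ hPQ (Finset.mem_univ i)

end Mechanism

theorem not_isTTC_mechanism {n : ℕ} {a b c d : Fin n} {Pr : Fin n → PrefRel n}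
    (H : Setting a b c d) (hP : ∀ i, IsStrictTotalOrder (Fin n) (Pr i))
    (hs : (∀ x, x ≠ a → Pr b a x) → second a b Pr ≠ b) (h : Modified a b c d Pr) :
    ¬ isTTC Pr (mechanism a b c d Pr) := by
  rintro ⟨-, r, hr⟩
  have hsa := (second_spec hP H.hab).1
  obtain ⟨ra, rb, -, -⟩ := rotate_values H hsa (hs h.2.1)
  rw [funext (mechanism_of_modified h)] at hr
  have := hP b
  have h1 := (hr a).1
  have h2 := (hr b).2 a
  rw [ra] at h1
  rw [rb] at h2
  exact asymm (h2 h1.le hsa.symm) (h.2.1 _ hsa)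

theorem stmt15 {n : ℕ} (hn : n ≤ 4) (D : Set (PrefRel n))
    (hD : ∀ P ∈ D, IsStrictTotalOrder (Fin n) P)
    (hfail : failsTopTwoFor D Set.univ) :
    ∃ φ : Profile n (fun _ => D) → Fin n → Fin n,
      (∀ P, Function.Bijective (φ P)) ∧ IR φ ∧ ParetoEff φ ∧ SP φ ∧
      ∃ P, ¬ isTTC P.1 (φ P) := by
  obtain ⟨a, b, -, -, hab, ⟨Pa, hPa, -, hPa'⟩, ⟨Pb, hPb, -, hPb'⟩, hno⟩ := hfail
  have hP (P : Profile n (fun _ => D)) (i : Fin n) := hD _ (P.2 i)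
  have hs (P : Profile n (fun _ => D)) (h : ∀ x, x ≠ a → P.1 b a x) : second a b P.1 ≠ b := by
    intro e
    obtain ⟨-, h2⟩ := second_spec (hP P) hab
    refine hno _ (P.2 b) ⟨trivial, fun x _ => h x⟩ ⟨⟨trivial, hab.symm⟩, fun x hx hxb => ?_⟩
    rw [e] at h2
    exact h2 x hx.2 hxb
  obtain ⟨d, c, H, hcd⟩ : ∃ d c, Setting a b c d ∧ (c ≠ d → Pb d c) := by
    have hne : (Finset.univ \ {a, b} : Finset (Fin n)).Nonempty := by
      obtain ⟨hsa, -⟩ := second_spec (hP ⟨fun _ => Pa, fun _ => hPa⟩) hab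
      have hsb := hs ⟨fun _ => Pa, fun _ => hPa⟩ fun x => hPa' x trivial
      exact ⟨_, Finset.mem_sdiff.2 ⟨Finset.mem_univ _, by simpa using ⟨hsa, hsb⟩⟩⟩
    obtain ⟨hd, hbest⟩ := best_spec (hD _ hPb) hne a
    generalize best Pb (Finset.univ \ {a, b}) a = d at hd hbest
    simp only [Finset.mem_sdiff, Finset.mem_univ, Finset.mem_insert, Finset.mem_singleton,
      true_and, not_or] at hd hbest
    by_cases hc : ∃ c, c ≠ a ∧ c ≠ b ∧ c ≠ d
    · obtain ⟨c, hca, hcb, hcd⟩ := hc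
      refine ⟨d, c, ⟨hab, Ne.symm hd.1, Ne.symm hd.2, hca, hcb, fun x => ?_⟩,
        hbest c ⟨hca, hcb⟩⟩
      by_contra! h
      have h5 : ({x, a, b, c, d} : Finset (Fin n)).card = 5 := by
        simp [Finset.card_insert_of_notMem, h, hab, hca.symm, hcb.symm, hcd, Ne.symm hd.1,
          Ne.symm hd.2]
      have := Finset.card_le_univ ({x, a, b, c, d} : Finset (Fin n))
      rw [h5, Fintype.card_fin] at this
      omega
    · push Not at hc
      refine ⟨d, d, ⟨hab, Ne.symm hd.1, Ne.symm hd.2, hd.1, hd.2, fun x => ?_⟩,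
        fun h => absurd rfl h⟩
      by_contra! h
      exact h.2.2.1 (hc x h.1 h.2.1)
  refine ⟨fun P => mechanism a b c d P.1,
    fun P => Finite.injective_iff_bijective.1 (mechanism_injective H (hP P) (hs P)),
    fun P => mechanism_individuallyRational H (hP P) (hs P),
    fun P y hy hge => mechanism_paretoEff H (hP P) (hs P) hy.injective hge,
    fun P Q i hPQ => mechanism_strategyproof H (hP P) (hP Q) (hs P) (hs Q) hPQ, ?_⟩
  let P : Profile n (fun _ => D) :=
    ⟨fun i => if i = a ∨ i = c ∧ c ≠ d then Pb else Pa, fun i => by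
      dsimp only
      split_ifs <;> assumption⟩
  refine ⟨P, not_isTTC_mechanism H (hP P) (hs P) ⟨fun x hx => ?_, fun x hx => ?_,
    fun h => ?_, fun x hx _ => ?_⟩⟩
  · simpa [P] using hPb' x trivial hx
  · simpa [P, H.hab.symm, H.hcb.symm] using hPa' x trivial hx
  · simpa [P, h] using hcd h
  · have h1 : ¬ (d = c ∧ c ≠ d) := fun h => h.2 h.1.symm
    simpa [P, H.had.symm, h1] using hPa' x trivial hx
end

section
/- For n ≤ 4, the following are equivalent for a domain D: (1) D satisfies the top-two condition; (2) TTC is the unique individually rational, Pareto efficient, and strategyproof mechanism on D^N; (3) TTC is the unique individually rational, pair efficient, and strategyproof mechanism on D^N. -/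
lemma rel_asymm {α : Type*} {P : α → α → Prop} (hP : IsStrictTotalOrder α P) {a b : α}
    (h : P a b) : ¬ P b a := fun h' => irrefl_of P a (trans_of P h h')

lemma top.eq_of_rel {α : Type*} {P : α → α → Prop} (hP : IsStrictTotalOrder α P) {S : Set α}
    {a b : α} (ha : top P S a) (hb : b ∈ S) (h : b = a ∨ P b a) : b = a := by
  by_contra hne
  exact rel_asymm hP (ha.2 b hb hne) (h.resolve_left hne)

lemma top.unique {α : Type*} {P : α → α → Prop} (hP : IsStrictTotalOrder α P) {S : Set α}
    {a b : α} (ha : top P S a) (hb : top P S b) : a = b := by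
  by_contra hne
  exact rel_asymm hP (ha.2 b hb.1 (Ne.symm hne)) (hb.2 a ha.1 hne)

lemma top.weak {α : Type*} {P : α → α → Prop} {S : Set α}
    {a b : α} (ha : top P S a) (hb : b ∈ S) : a = b ∨ P a b := by
  by_cases h : b = a
  · exact Or.inl h.symm
  · exact Or.inr (ha.2 b hb h)

lemma exists_top {α : Type*} [Finite α] {P : α → α → Prop} (hP : IsStrictTotalOrder α P)
    {S : Set α} (hS : S.Nonempty) : ∃ a, top P S a := by
  obtain ⟨a, ha, h⟩ := (Finite.wellFounded_of_trans_of_irrefl P).has_min S hS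
  refine ⟨a, ha, fun c hc hne => ?_⟩
  rcases trichotomous_of P a c with h1 | h1 | h1
  · exact h1
  · exact absurd h1.symm hne
  · exact absurd h1 (h c hc)

/-- Every finite set of agents closed under a self-map of the agents contains a cycle of that
map, so the recursive removal of cycles defines a TTC allocation. -/
lemma exists_ttc_on {n : ℕ} (Pr : Fin n → PrefRel n)
    (hPr : ∀ i, IsStrictTotalOrder (Fin n) (Pr i)) (A : Finset (Fin n)) :
    ∃ x : Fin n → Fin n, Set.BijOn x A A ∧ ∃ r : Fin n → ℕ, ∀ i ∈ A,
      r (x i) = r i ∧ ∀ o ∈ A, r i ≤ r o → o ≠ x i → Pr i (x i) o := by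
  classical
  induction A using Finset.strongInduction with
  | H A ih =>
  rcases A.eq_empty_or_nonempty with rfl | hA
  · exact ⟨id, by simp, 0, by simp⟩
  choose f hf using fun i => exists_top (hPr i) (S := (A : Set (Fin n))) hA
  have hfA : ∀ i, f i ∈ A := fun i => (hf i).1
  have hsub : ∀ i ∈ Function.periodicPts f, i ∈ A := by
    rintro i ⟨k, hk, hi⟩
    obtain ⟨m, rfl⟩ := Nat.exists_eq_succ_of_ne_zero hk.ne'
    rw [← hi.eq, Function.iterate_succ_apply']
    exact hfA _
  obtain ⟨i₀, hi₀⟩ : (Function.periodicPts f).Nonempty := by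
    obtain ⟨i, -⟩ := hA
    obtain ⟨k, l, hkl, h⟩ := Finite.exists_ne_map_eq_of_infinite (fun k : ℕ => f^[k] i)
    wlog hlt : k < l generalizing k l
    · exact this l k hkl.symm h.symm (lt_of_le_of_ne (not_lt.1 hlt) hkl.symm)
    refine ⟨f^[k] i, Function.mk_mem_periodicPts (n := l - k) (by omega) ?_⟩
    change f^[l - k] (f^[k] i) = f^[k] i
    rw [← Function.iterate_add_apply, Nat.sub_add_cancel hlt.le]
    exact h.symm
  obtain ⟨x, hx, r, hr⟩ := ih (A.filter (· ∉ Function.periodicPts f))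
    (Finset.filter_ssubset.2 ⟨i₀, hsub _ hi₀, by simpa using hi₀⟩)
  have hper := Function.bijOn_periodicPts f
  have hxm : ∀ i ∈ A, i ∉ Function.periodicPts f → x i ∈ A ∧ x i ∉ Function.periodicPts f := by
    intro i hi hi'
    simpa using hx.mapsTo (by simp [hi, hi'] : i ∈ _)
  refine ⟨fun i => if i ∈ Function.periodicPts f then f i else x i, ?_,
    fun i => if i ∈ Function.periodicPts f then 0 else r i + 1, fun i hi => ?_⟩
  · refine ⟨fun i hi => ?_, fun i hi j hj hij => ?_, fun o ho => ?_⟩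
    · by_cases h : i ∈ Function.periodicPts f
      · simpa [h] using hfA i
      · simpa [h] using (hxm i hi h).1
    · by_cases h : i ∈ Function.periodicPts f <;> by_cases h' : j ∈ Function.periodicPts f <;>
        simp only [h, h', if_true, if_false] at hij
      · exact hper.injOn h h' hij
      · exact absurd (hij ▸ hper.mapsTo h) (hxm j hj h').2
      · exact absurd (hij ▸ hper.mapsTo h') (hxm i hi h).2
      · exact hx.injOn (by simpa [h] using hi) (by simpa [h'] using hj) hij
    · by_cases h : o ∈ Function.periodicPts f
      · obtain ⟨i, hi, rfl⟩ := hper.surjOn h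
        exact ⟨i, hsub i hi, by simp [hi]⟩
      · obtain ⟨i, hi, rfl⟩ := hx.surjOn (by simpa [h] using ho : o ∈ _)
        simp only [Finset.coe_filter, Set.mem_ofPred_eq] at hi
        exact ⟨i, hi.1, by simp [hi.2]⟩
  · by_cases h : i ∈ Function.periodicPts f
    · have hfi := hper.mapsTo h
      simp only [h, hfi, if_true]
      exact ⟨trivial, fun o ho _ hne => (hf i).2 o ho hne⟩
    · have h1 := hxm i hi h
      have h2 := hr i (by simp [hi, h])
      simp only [h, h1.2, if_false]
      refine ⟨by rw [h2.1], fun o ho hle hne => ?_⟩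
      by_cases h' : o ∈ Function.periodicPts f
      · simp [h'] at hle
      · exact h2.2 o (by simp [ho, h']) (by simpa [h'] using hle) hne

lemma exists_ttc {n : ℕ} (Pr : Fin n → PrefRel n)
    (hPr : ∀ i, IsStrictTotalOrder (Fin n) (Pr i)) : ∃ x, isTTC Pr x := by
  obtain ⟨x, hx, r, hr⟩ := exists_ttc_on Pr hPr Finset.univ
  exact ⟨x, by simpa using hx, r, fun i => by simpa using hr i (Finset.mem_univ i)⟩

/-- Two TTC allocations agree on the rounds of the first one in which reports coincide. -/
lemma ttc_agree {n : ℕ} {Pr Qr : Fin n → PrefRel n}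
    (hPr : ∀ i, IsStrictTotalOrder (Fin n) (Pr i)) {x x' : Fin n → Fin n}
    (hx : Function.Bijective x) (hx' : Function.Bijective x') {r r' : Fin n → ℕ}
    (hr : ∀ i, r (x i) = r i ∧ ∀ o, r i ≤ r o → o ≠ x i → Pr i (x i) o)
    (hr' : ∀ i, r' (x' i) = r' i ∧ ∀ o, r' i ≤ r' o → o ≠ x' i → Qr i (x' i) o)
    (T : ℕ) (hPQ : ∀ k, r k < T → Pr k = Qr k) : ∀ k, r k < T → x k = x' k := by
  induction T with
  | zero => simp
  | succ t ih =>
  have ih := ih fun k hk => hPQ k (hk.trans t.lt_succ_self)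
  have hlow : ∀ k, r k = t → t ≤ r (x' k) := by
    intro k hk
    by_contra! hlt
    obtain ⟨m, hm⟩ := hx.surjective (x' k)
    have hm' : r m < t := by rw [← (hr m).1, hm]; exact hlt
    rw [hx'.injective ((ih m hm').symm.trans hm)] at hm'
    omega
  have hstep : ∀ k, r k = t → x k ≠ x' k → r' (x k) < r' k := by
    intro k hk hne
    by_contra! hle
    have h1 := (hr' k).2 (x k) hle hne
    have h2 := (hr k).2 (x' k) (hk ▸ hlow k hk) (Ne.symm hne)
    rw [← hPQ k (by omega)] at h1
    exact rel_asymm (hPr k) h1 h2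
  have hle : ∀ k ∈ Finset.univ, (if r (x k) = t then r' (x k) else 0) ≤
      (if r k = t then r' k else 0) := by
    intro k _
    rw [(hr k).1]
    split_ifs with hk
    · by_cases he : x k = x' k
      · rw [he, (hr' k).1]
      · exact (hstep k hk he).le
    · exact le_rfl
  have hsum := (Finset.sum_eq_sum_iff_of_le hle).1
    ((Equiv.ofBijective x hx).sum_comp fun k => if r k = t then r' k else 0)
  intro k hk
  rcases Nat.lt_succ_iff_lt_or_eq.1 hk with hk | hk
  · exact ih k hk
  · by_contra hne
    have h1 := hsum k (Finset.mem_univ k)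
    rw [(hr k).1, if_pos hk, if_pos hk] at h1
    exact (hstep k hk hne).ne h1

lemma isTTC.ir {n : ℕ} {Pr : Fin n → PrefRel n} {x : Fin n → Fin n} (h : isTTC Pr x) (i : Fin n) :
    x i = i ∨ Pr i (x i) i := by
  obtain ⟨-, r, hr⟩ := h
  by_cases hi : i = x i
  · exact Or.inl hi.symm
  · exact Or.inr ((hr i).2 i le_rfl hi)

lemma isTTC.pareto {n : ℕ} {Pr : Fin n → PrefRel n}
    (hPr : ∀ i, IsStrictTotalOrder (Fin n) (Pr i)) {x : Fin n → Fin n} (h : isTTC Pr x)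
    {y : Fin n → Fin n} (hy : Function.Bijective y) (hyx : ∀ i, y i = x i ∨ Pr i (y i) (x i))
    (i : Fin n) : y i = x i := by
  obtain ⟨hx, r, hr⟩ := h
  induction hk : r i using Nat.strong_induction_on generalizing i with
  | _ k ih =>
  have hle : r i ≤ r (y i) := by
    by_contra! hlt
    obtain ⟨m, hm⟩ := hx.surjective (y i)
    have hm' : r m < k := by rw [← (hr m).1, hm]; omega
    have := hy.injective ((ih _ hm' m rfl).trans hm)
    subst this
    omega
  by_contra hne
  exact rel_asymm (hPr i) ((hyx i).resolve_left hne) ((hr i).2 _ hle hne)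

lemma isTTC.strategyproof {n : ℕ} {Pr Qr : Fin n → PrefRel n}
    (hPr : ∀ i, IsStrictTotalOrder (Fin n) (Pr i)) {x x' : Fin n → Fin n} (h : isTTC Pr x)
    (h' : isTTC Qr x') (i : Fin n) (hPQ : ∀ j, j ≠ i → Qr j = Pr j) :
    x i = x' i ∨ Pr i (x i) (x' i) := by
  obtain ⟨hx, r, hr⟩ := h
  obtain ⟨hx', r', hr'⟩ := h'
  have hag := ttc_agree hPr hx hx' hr hr' (r i)
    fun k hk => (hPQ k (by rintro rfl; exact lt_irrefl _ hk)).symm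
  by_cases hne : x' i = x i
  · exact Or.inl hne.symm
  refine Or.inr ((hr i).2 _ ?_ hne)
  by_contra! hlt
  obtain ⟨m, hm⟩ := hx.surjective (x' i)
  have hm' : r m < r i := by rw [← (hr m).1, hm]; exact hlt
  have := hx'.injective ((hag m hm').symm.trans hm)
  subst this
  exact lt_irrefl _ hm'

lemma ParetoEff.pairEff {n : ℕ} {Ds : Fin n → Set (PrefRel n)}
    {φ : Profile n Ds → Fin n → Fin n} (hφ : ∀ P, Function.Bijective (φ P))
    (hirr : ∀ (P : Profile n Ds) i a, ¬ P.1 i a a) (h : ParetoEff φ) : PairEff φ := by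
  rintro P i j ⟨h1, h2⟩
  have hij := h P (φ P ∘ Equiv.swap i j) ((hφ P).comp (Equiv.swap i j).bijective) ?_ i
  · rw [Function.comp_apply, Equiv.swap_apply_left] at hij
    exact hirr P i _ (hij ▸ h1)
  · intro k
    rcases eq_or_ne k i with rfl | hi
    · simpa using Or.inr h1
    rcases eq_or_ne k j with rfl | hj
    · simpa using Or.inr h2
    · simp [Equiv.swap_apply_of_ne_of_ne hi hj]

/-- The profile obtained from `P` when agent `i` reports `R` instead. -/
def Profile.update {n : ℕ} {D : Set (PrefRel n)} (P : Profile n fun _ => D) (i : Fin n)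
    {R : PrefRel n} (hR : R ∈ D) : Profile n fun _ => D :=
  ⟨Function.update P.1 i R, fun j => by
    rcases eq_or_ne j i with rfl | h
    · simpa using hR
    · simpa [h] using P.2 j⟩

lemma Profile.update_self {n : ℕ} {D : Set (PrefRel n)} (P : Profile n fun _ => D) (i : Fin n)
    {R : PrefRel n} (hR : R ∈ D) : (P.update i hR).1 i = R :=
  Function.update_self ..

lemma Profile.update_of_ne {n : ℕ} {D : Set (PrefRel n)} (P : Profile n fun _ => D) {i j : Fin n}
    (h : j ≠ i) {R : PrefRel n} (hR : R ∈ D) : (P.update i hR).1 j = P.1 j :=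
  Function.update_of_ne h ..

section Uniqueness

variable {n : ℕ} {D : Set (PrefRel n)} (hD : ∀ P ∈ D, IsStrictTotalOrder (Fin n) P)
  (htt : topTwo D) {φ : Profile n (fun _ => D) → Fin n → Fin n}
  (hbij : ∀ P, Function.Bijective (φ P)) (hir : IR φ) (hpe : PairEff φ) (hsp : SP φ)

include hD hir in
lemma IR.eq_top_or_self {A : Set (Fin n)} {P : Profile n fun _ => D} {i j : Fin n}
    (hj : top (P.1 i) A j) (hi : i ∈ A) (hi' : j ≠ i → top (P.1 i) (A \ {j}) i)
    (hφ : φ P i ∈ A) : φ P i = j ∨ φ P i = i := by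
  by_contra! h
  have h1 := (hir P i).resolve_left h.2
  rcases eq_or_ne j i with rfl | hne
  · exact rel_asymm (hD _ (P.2 j)) h1 (hj.2 _ hφ h.1)
  · exact rel_asymm (hD _ (P.2 i)) h1 ((hi' hne).2 _ ⟨hφ, h.1⟩ h.2)

include hD hsp in
/-- An agent who can obtain the best object of `A` by a misreport obtains it. -/
lemma SP.eq_top {A : Set (Fin n)} {P Q : Profile n fun _ => D} {i j : Fin n}
    (hPQ : ∀ k, k ≠ i → Q.1 k = P.1 k) (hj : top (P.1 i) A j) (hφ : φ P i ∈ A)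
    (hQ : φ Q i = j) : φ P i = j :=
  hj.eq_of_rel (hD _ (P.2 i)) hφ (hQ ▸ hsp P Q i hPQ)

include hD htt hbij hir hpe hsp in
/-- Agents who rank first, within the remaining objects `A`, their successor in a permutation, and
second their own endowment, receive their successor. Long cycles are shortened by letting an agent
skip its successor. -/
lemma cycle_of_topTwo_reports {A : Set (Fin n)} {P₀ : Profile n fun _ => D}
    (hA : ∀ P : Profile n fun _ => D, (∀ k ∉ A, P.1 k = P₀.1 k) → ∀ i ∈ A, φ P i ∈ A)
    (S : Finset (Fin n)) (σ : Equiv.Perm (Fin n)) (hSA : ∀ i ∈ S, i ∈ A)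
    (hσ : ∀ i ∈ S, σ i ∈ S) (hS : ∀ i ∈ S, ∃ R ∈ D, top R A i) (P : Profile n fun _ => D)
    (hP : ∀ k ∉ A, P.1 k = P₀.1 k)
    (htop : ∀ i ∈ S, top (P.1 i) A (σ i) ∧ (σ i ≠ i → top (P.1 i) (A \ {σ i}) i)) :
    ∀ i ∈ S, φ P i = σ i := by
  classical
  induction S using Finset.strongInduction generalizing σ P with
  | H S ih =>
  intro i hi
  have htwo : ∀ k ∈ S, φ P k = σ k ∨ φ P k = k := fun k hk =>
    hir.eq_top_or_self hD (htop k hk).1 (hSA k hk) (htop k hk).2 (hA P hP k (hSA k hk))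
  by_contra hne
  have hii : φ P i = i := (htwo i hi).resolve_left hne
  have hij : σ i ≠ i := fun h => hne (hii.trans h.symm)
  set j := σ i with hj
  have hjS : j ∈ S := hσ i hi
  set m := σ j with hm
  have hmS : m ∈ S := hσ j hjS
  have hjm : j ≠ m := fun h => hij (σ.injective h).symm
  by_cases hmi : m = i
  · have hjj : φ P j = j := (htwo j hjS).resolve_left fun h =>
      hij ((hbij P).injective (hii.trans (hmi.symm.trans h.symm))).symm
    refine hpe P i j ⟨?_, ?_⟩
    · rw [hii, hjj]
      exact (htop i hi).1.2 i (hSA i hi) hij.symm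
    · rw [hii, hjj, ← hmi]
      exact (htop j hjS).1.2 j (hSA j hjS) hjm
  have hout : ∀ {R : PrefRel n} (hR : R ∈ D), ∀ k ∉ A, (P.update i hR).1 k = P₀.1 k := by
    intro R hR k hk
    rw [P.update_of_ne (by rintro rfl; exact hk (hSA _ hi)), hP k hk]
  obtain ⟨Q, hQ, hQm, hQi⟩ := htt A ⟨i, hSA i hi⟩ m i (hSA m hmS) (hSA i hi) hmi
    (hS m hmS) (hS i hi)
  have hskip : φ (P.update i hQ) i = m := by
    have hσi : (σ * Equiv.swap i j) i = m := by simp [hm]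
    have hσk : ∀ k, k ≠ i → k ≠ j → (σ * Equiv.swap i j) k = σ k := fun k h1 h2 => by
      simp [Equiv.swap_apply_of_ne_of_ne h1 h2]
    rw [← hσi]
    refine ih (S.erase j) (Finset.erase_ssubset hjS) (σ * Equiv.swap i j)
      (fun k hk => hSA k (Finset.mem_of_mem_erase hk)) (fun k hk => ?_)
      (fun k hk => hS k (Finset.mem_of_mem_erase hk)) _ (hout hQ) (fun k hk => ?_) i
      (Finset.mem_erase.2 ⟨hij.symm, hi⟩)
    all_goals
      obtain ⟨hkj, hkS⟩ := Finset.mem_erase.1 hk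
      rcases eq_or_ne k i with rfl | hki
    · rw [hσi]
      exact Finset.mem_erase.2 ⟨hjm.symm, hmS⟩
    · rw [hσk k hki hkj]
      exact Finset.mem_erase.2 ⟨fun h => hki (σ.injective h), hσ k hkS⟩
    · rw [hσi, P.update_self]
      exact ⟨hQm, fun _ => hQi⟩
    · rw [hσk k hki hkj, P.update_of_ne hki]
      exact htop k hkS
  obtain ⟨R, hR, hRj, hRm⟩ := htt A ⟨i, hSA i hi⟩ j m (hSA j hjS) (hSA m hmS) hjm
    (hS j hjS) (hS m hmS)
  have hRi : φ (P.update i hR) i = m := by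
    have hmem := hA _ (hout hR) i (hSA i hi)
    have hnj : φ (P.update i hR) i ≠ j := fun h => hne <|
      hsp.eq_top hD (fun k hk => P.update_of_ne hk hR) (htop i hi).1 (hA P hP i (hSA i hi)) h
    have := hsp (P.update i hR) (P.update i hQ) i fun k hk => by
      rw [P.update_of_ne hk, P.update_of_ne hk]
    rw [hskip, P.update_self] at this
    exact hRm.eq_of_rel (hD R hR) ⟨hmem, hnj⟩ this
  have hPj : (P.update i hR).1 j = P.1 j := P.update_of_ne hij hR
  have hRj' : φ (P.update i hR) j = j := by
    refine (hir.eq_top_or_self (P := P.update i hR) hD (hPj ▸ (htop j hjS).1) (hSA j hjS)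
      (hPj ▸ (htop j hjS).2) (hA _ (hout hR) j (hSA j hjS))).resolve_left fun h => ?_
    exact hij ((hbij (P.update i hR)).injective (h.trans hRi.symm))
  refine hpe (P.update i hR) i j ⟨?_, ?_⟩
  · rw [hRi, hRj', P.update_self]
    exact hRj.2 m (hSA m hmS) hjm.symm
  · rw [hRi, hRj', hPj]
    exact (htop j hjS).1.2 j (hSA j hjS) hjm

include hD htt hbij hir hpe hsp in
lemma cycle_of_top_reports {A : Set (Fin n)} {P₀ : Profile n fun _ => D}
    (hA : ∀ P : Profile n fun _ => D, (∀ k ∉ A, P.1 k = P₀.1 k) → ∀ i ∈ A, φ P i ∈ A)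
    (S : Finset (Fin n)) (σ : Equiv.Perm (Fin n)) (hSA : ∀ i ∈ S, i ∈ A)
    (hσ : ∀ i ∈ S, σ i ∈ S) (hS : ∀ i ∈ S, ∃ R ∈ D, top R A i) (P : Profile n fun _ => D)
    (hP : ∀ k ∉ A, P.1 k = P₀.1 k) (htop : ∀ i ∈ S, top (P.1 i) A (σ i)) :
    ∀ i ∈ S, φ P i = σ i := by
  classical
  induction hB : S.filter (fun i => ¬ (σ i ≠ i → top (P.1 i) (A \ {σ i}) i))
    using Finset.strongInduction generalizing P with
  | H B ih =>
  subst hB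
  have hbad : ∀ i ∈ S, ¬ (σ i ≠ i → top (P.1 i) (A \ {σ i}) i) → φ P i = σ i := by
    intro i hi h
    have hne : σ i ≠ i := fun h' => h fun h'' => absurd h' h''
    obtain ⟨R, hR, hR1, hR2⟩ := htt A ⟨i, hSA i hi⟩ (σ i) i (hSA _ (hσ i hi)) (hSA i hi) hne
      (hS _ (hσ i hi)) (hS i hi)
    refine hsp.eq_top hD (fun k hk => P.update_of_ne hk hR) (htop i hi) (hA P hP i (hSA i hi))
      (ih _ ?_ (P.update i hR) (fun k hk => ?_) (fun k hk => ?_) rfl i hi)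
    · refine Finset.ssubset_iff_of_subset (fun k hk => ?_) |>.2 ⟨i, ?_, ?_⟩
      · obtain ⟨hkS, hk⟩ := Finset.mem_filter.1 hk
        rcases eq_or_ne k i with rfl | hki
        · exact Finset.mem_filter.2 ⟨hi, h⟩
        · rw [P.update_of_ne hki] at hk
          exact Finset.mem_filter.2 ⟨hkS, hk⟩
      · exact Finset.mem_filter.2 ⟨hi, h⟩
      · rw [Finset.mem_filter, P.update_self]
        exact fun h => h.2 fun _ => hR2
    · rw [P.update_of_ne (by rintro rfl; exact hk (hSA _ hi)), hP k hk]
    · rcases eq_or_ne k i with rfl | hki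
      · rwa [P.update_self]
      · rw [P.update_of_ne hki]
        exact htop k hk
  have hgood : ∀ i ∈ S.filter (fun i => φ P i ≠ σ i),
      (σ i ≠ i → top (P.1 i) (A \ {σ i}) i) ∧ φ P i = i := by
    intro i hi
    obtain ⟨hiS, hi⟩ := Finset.mem_filter.1 hi
    have h := not_not.1 fun h => hi (hbad i hiS h)
    exact ⟨h, (hir.eq_top_or_self hD (htop i hiS) (hSA i hiS) h
      (hA P hP i (hSA i hiS))).resolve_left hi⟩
  have hback : ∀ i ∈ S.filter (fun i => φ P i ≠ σ i),
      σ.symm i ∈ S.filter (fun i => φ P i ≠ σ i) := by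
    intro i hi
    have hii := (hgood i hi).2
    obtain ⟨hiS, hi⟩ := Finset.mem_filter.1 hi
    refine Finset.mem_filter.2 ⟨Equiv.Perm.perm_symm_on_of_perm_on_finset hσ hiS, fun h => hi ?_⟩
    rw [Equiv.apply_symm_apply] at h
    have := (hbij P).injective (h.trans hii.symm)
    exact hii.trans (σ.symm_apply_eq.1 this)
  have hfwd : ∀ i ∈ S.filter (fun i => φ P i ≠ σ i), σ i ∈ S.filter (fun i => φ P i ≠ σ i) := by
    intro i hi
    simpa using Equiv.Perm.perm_symm_on_of_perm_on_finset hback hi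
  intro i hi
  by_contra hne
  exact hne <| cycle_of_topTwo_reports hD htt hbij hir hpe hsp hA _ σ
    (fun k hk => hSA k (Finset.mem_filter.1 hk).1) hfwd
    (fun k hk => hS k (Finset.mem_filter.1 hk).1) P hP
    (fun k hk => ⟨htop k (Finset.mem_filter.1 hk).1, (hgood k hk).1⟩) i
    (Finset.mem_filter.2 ⟨hi, hne⟩)

include hD htt hbij hir hpe hsp in
lemma eq_ttc_of_topTwo {P : Profile n fun _ => D} {x : Fin n → Fin n} (hx : isTTC P.1 x) :
    φ P = x := by
  classical
  obtain ⟨hxb, r, hr⟩ := hx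
  suffices h : ∀ t, ∀ P' : Profile n fun _ => D, (∀ k, r k < t → P'.1 k = P.1 k) →
      ∀ i, r i < t → φ P' i = x i from
    funext fun i => h (r i + 1) P (fun _ _ => rfl) i (Nat.lt_succ_self _)
  intro t
  induction t with
  | zero => simp
  | succ t ih =>
  intro P' hP' i hi
  rcases Nat.lt_succ_iff_lt_or_eq.1 hi with hi | hi
  · exact ih P' (fun k hk => hP' k (by omega)) i hi
  refine cycle_of_top_reports hD htt hbij hir hpe hsp (A := {k | t ≤ r k}) (P₀ := P')
    (fun Q hQ k hk => ?_) (Finset.univ.filter fun k => r k = t) (Equiv.ofBijective x hxb)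
    (fun k hk => ?_) (fun k hk => ?_) (fun k hk => ?_) P' (fun _ _ => rfl) (fun k hk => ?_) i
    (by simpa using hi)
  · change t ≤ r (φ Q k)
    by_contra! hlt
    obtain ⟨m, hm⟩ := hxb.surjective (φ Q k)
    have hm' : r m < t := by rw [← (hr m).1, hm]; exact hlt
    have := ih Q (fun l hl => (hQ l (not_le.2 hl)).trans (hP' l (by omega))) m hm'
    rw [(hbij Q).injective (this.trans hm)] at hm'
    exact absurd hk (not_le.2 hm')
  all_goals simp only [Finset.mem_filter, Finset.mem_univ, true_and] at hk
  · exact hk.ge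
  · simpa [(hr k).1] using hk
  · obtain ⟨m, rfl⟩ := hxb.surjective k
    rw [(hr m).1] at hk
    exact ⟨P.1 m, P.2 m, by simp [(hr m).1, hk], fun c hc => (hr m).2 c (hk ▸ hc)⟩
  · rw [hP' k (by omega)]
    exact ⟨by simp [(hr k).1, hk], fun c hc => (hr k).2 c (hk ▸ hc)⟩

end Uniqueness

/-- The allocation in which agent `a` receives `b`, agent `b` receives `x`, the favourite map `t` is
followed from `x` for up to two steps, and everybody else keeps their endowment. -/
def diverted {n : ℕ} (a b x : Fin n) (t : Fin n → Fin n) (i : Fin n) : Fin n :=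
  if i = a then b else if i = b then x else if i = x ∨ i = t x then t i else i

/-- Every agent of `E` other than `a`, `b` is led to `a` by at most two applications of the
favourite map `t`. -/
def LeadsTo {n : ℕ} (E : Set (Fin n)) (a b : Fin n) (t : Fin n → Fin n) : Prop :=
  ∀ i ∈ E, i ≠ a → i ≠ b → t i = a ∨ t (t i) = a

section Diversion

variable {n : ℕ} {E : Set (Fin n)} {a b : Fin n}

lemma diverted_injective {x : Fin n} {t : Fin n → Fin n}
    (hx : x ∈ E ∧ x ≠ a ∧ x ≠ b) (ht : ∀ i, t i ∈ E ∧ t i ≠ b) (hlead : LeadsTo E a b t) :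
    Function.Injective (diverted a b x t) := by
  have hx' := hlead x hx.1 hx.2.1 hx.2.2
  have h1 := ht x
  have h2 := ht (t x)
  intro i j hij
  unfold diverted at hij
  grind

lemma diverted_of_notMem {x : Fin n} {t : Fin n → Fin n} (ha : a ∈ E) (hb : b ∈ E) (hx : x ∈ E)
    (ht : t x ∈ E) {k : Fin n} (hk : k ∉ E) : diverted a b x t k = k := by
  unfold diverted
  grind

lemma diverted_pareto {Pr : Fin n → PrefRel n} (hPr : ∀ i, IsStrictTotalOrder (Fin n) (Pr i))
    {x : Fin n} {t : Fin n → Fin n} (hab : a ≠ b) (ha : a ∈ E) (hb : b ∈ E)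
    (hcard : ∀ i j l, i ∈ E \ {a, b} → j ∈ E \ {a, b} → l ∈ E \ {a, b} → i = j ∨ j = l ∨ i = l)
    (hout : ∀ k ∉ E, top (Pr k) Set.univ k) (hab' : top (Pr a) E b)
    (hbx : top (Pr b) (E \ {a}) x) (hxb : x ≠ b)
    (ht : ∀ i, top (Pr i) (E \ {b}) (t i)) (hlead : LeadsTo E a b t)
    {y : Fin n → Fin n} (hy : Function.Bijective y)
    (hyx : ∀ i, y i = diverted a b x t i ∨ Pr i (y i) (diverted a b x t i)) (i : Fin n) :
    y i = diverted a b x t i := by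
  have hxE : x ∈ E ∧ x ≠ a ∧ x ≠ b := ⟨hbx.1.1, hbx.1.2, hxb⟩
  have htx := (ht x).1
  have htb : ∀ i, t i ≠ b := fun i => (ht i).1.2
  have hinj := hy.injective
  have hk : ∀ k ∉ E, y k = k := fun k hk =>
    (hout k hk).eq_of_rel (hPr k) trivial
      (by simpa only [diverted_of_notMem ha hb hxE.1 htx.1 hk] using hyx k)
  have hE : ∀ k ∈ E, y k ∈ E := fun k hk' => by
    by_contra h
    exact h ((hinj (hk _ h)).symm ▸ hk')
  have hya : y a = b :=
    hab'.eq_of_rel (hPr a) (hE a ha) (by simpa [diverted] using hyx a)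
  have hnb : ∀ k, k ≠ a → y k ≠ b := fun k hk h => hk (hinj (h.trans hya.symm))
  have hyx1 : y x = t x :=
    (ht x).eq_of_rel (hPr x) ⟨hE x hxE.1, hnb x hxE.2.1⟩
      (by simpa [diverted, hxE.2.1, hxE.2.2] using hyx x)
  have hyx2 : t x ≠ a → y (t x) = t (t x) := fun h =>
    (ht _).eq_of_rel (hPr _) ⟨hE _ htx.1, hnb _ h⟩
      (by simpa [diverted, h, htb x] using hyx (t x))
  have hlx := hlead x hxE.1 hxE.2.1 hxE.2.2
  have hyb_ne : y b ≠ a := by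
    intro h
    rcases eq_or_ne (t x) a with h1 | h1
    · exact hxb (hinj (hyx1.trans (h1.trans h.symm)))
    · exact htb x (hinj ((hyx2 h1).trans ((hlx.resolve_left h1).trans h.symm)))
  have hyb : y b = x :=
    hbx.eq_of_rel (hPr b) ⟨hE b hb, hyb_ne⟩ (by simpa [diverted, hab.symm] using hyx b)
  by_cases hiE : i ∈ E
  swap
  · rw [hk i hiE, diverted_of_notMem ha hb hxE.1 htx.1 hiE]
  unfold diverted
  split_ifs with h1 h2 h3
  · rw [h1, hya]
  · rw [h2, hyb]
  · rcases h3 with rfl | rfl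
    · exact hyx1
    · exact hyx2 h1
  · obtain ⟨h3, h4⟩ := not_or.1 h3
    have hyiE := hE i hiE
    have hyib := hnb i h1
    have hc := hcard i x
    simp only [Set.mem_sdiff, Set.mem_insert_iff, Set.mem_singleton_iff, not_or] at hc
    rcases eq_or_ne (t x) a with h5 | h5
    · have hyia : y i ≠ a := fun h => h3 (hinj (h.trans (h5.symm.trans hyx1.symm)))
      have hyix : y i ≠ x := fun h => h2 (hinj (h.trans hyb.symm))
      grind
    · have := hinj.ne h4
      have hxx : t x ≠ x := fun h => by
        rw [h] at hlx
        grind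
      grind

lemma isTTC.swap_of_tops {Pr : Fin n → PrefRel n}
    (hPr : ∀ i, IsStrictTotalOrder (Fin n) (Pr i)) {z : Fin n → Fin n} (hz : isTTC Pr z)
    (hout : ∀ k ∉ E, z k = k) (hab : top (Pr a) E b) (hba : top (Pr b) E a) :
    z a = b ∧ z b = a := by
  obtain ⟨hzb, r, hr⟩ := hz
  have hE : ∀ k ∈ E, z k ∈ E := fun k hk => by
    by_contra h
    exact h ((hzb.injective (hout _ h)).symm ▸ hk)
  have key : ∀ c ∈ E, ∀ d, top (Pr c) E d → r c ≤ r d → z c = d := by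
    intro c hc d hd hle
    by_contra hne
    exact rel_asymm (hPr c) ((hr c).2 d hle (Ne.symm hne)) (hd.2 _ (hE c hc) hne)
  rcases le_total (r a) (r b) with h | h
  · have h1 := key a hba.1 b hab h
    have h2 := (hr a).1
    rw [h1] at h2
    exact ⟨h1, key b hab.1 a hba h2.le⟩
  · have h1 := key b hab.1 a hba h
    have h2 := (hr b).1
    rw [h1] at h2
    exact ⟨key a hba.1 b hab h2.le, h1⟩

lemma isTTC.self_of_top {Pr : Fin n → PrefRel n} (hPr : ∀ i, IsStrictTotalOrder (Fin n) (Pr i))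
    {z : Fin n → Fin n} (hz : isTTC Pr z) {k : Fin n} (hk : top (Pr k) Set.univ k) : z k = k :=
  hk.eq_of_rel (hPr k) trivial (hz.ir k)

/-- If the favourites of the other agents of `E` lead to `a`, and `a` ranks `b` first, then `b`
receives its favourite object of `E`. -/
lemma isTTC.top_of_leadsTo {Pr : Fin n → PrefRel n}
    (hPr : ∀ i, IsStrictTotalOrder (Fin n) (Pr i)) {z : Fin n → Fin n} (hz : isTTC Pr z)
    (hout : ∀ k ∉ E, z k = k) (hb : b ∈ E) {t : Fin n → Fin n} (hab : top (Pr a) E b) (ha : a ∈ E)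
    (ht : ∀ i, top (Pr i) (E \ {b}) (t i)) (hlead : LeadsTo E a b t) : top (Pr b) E (z b) := by
  obtain ⟨hzb, r, hr⟩ := hz
  have hE : ∀ k ∈ E, z k ∈ E := fun k hk => by
    by_contra h
    exact h ((hzb.injective (hout _ h)).symm ▸ hk)
  have key : ∀ c ∈ E, ∀ d, top (Pr c) E d → r c ≤ r d → z c = d := by
    intro c hc d hd hle
    by_contra hne
    exact rel_asymm (hPr c) ((hr c).2 d hle (Ne.symm hne)) (hd.2 _ (hE c hc) hne)
  have hmono : ∀ c ∈ E, ∀ d, top (Pr c) E d → r d ≤ r c := by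
    intro c hc d hd
    by_contra! hlt
    have := (hr c).1
    rw [key c hc d hd hlt.le] at this
    omega
  have hstep : ∀ c ∈ E, r b ≤ r c ∨ r (t c) ≤ r c := by
    intro c hc
    obtain ⟨d, hd⟩ := exists_top (hPr c) ⟨c, hc⟩
    by_cases hdb : d = b
    · exact Or.inl (hmono c hc b (hdb ▸ hd))
    · have : t c = d := (ht c).unique (hPr c) ⟨⟨hd.1, hdb⟩, fun e he => hd.2 e he.1⟩
      exact Or.inr (hmono c hc _ (this ▸ hd))
  have hra := hmono a ha b hab
  have hr' : ∀ c ∈ E, r b ≤ r c := by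
    intro c hc
    rcases eq_or_ne c a with rfl | hca
    · exact hra
    rcases eq_or_ne c b with rfl | hcb
    · exact le_rfl
    rcases hstep c hc with h | h
    · exact h
    rcases hlead c hc hca hcb with h1 | h1
    · rw [h1] at h
      exact hra.trans h
    · rcases hstep (t c) (ht c).1.1 with h2 | h2
      · exact h2.trans h
      · rw [h1] at h2
        exact hra.trans (h2.trans h)
  obtain ⟨d, hd⟩ := exists_top (hPr b) ⟨b, hb⟩
  rwa [key b hb d hd (hr' d hd.1)]

/-- If changing the favourite of `c` alone destroys `LeadsTo`, then `c` points to itself or forms a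
two-cycle. -/
lemma LeadsTo.cycle_of_not {c : Fin n} {t u : Fin n → Fin n}
    (hcard : ∀ i j l, i ∈ E \ {a, b} → j ∈ E \ {a, b} → l ∈ E \ {a, b} → i = j ∨ j = l ∨ i = l)
    (hc : c ∈ E \ {a, b}) (ht : ∀ i, t i ∈ E \ {b}) (htu : ∀ i, i ≠ c → t i = u i)
    (hu : LeadsTo E a b u) (h : ¬ LeadsTo E a b t) :
    t c ≠ a ∧ (t c = c ∨ t c ≠ c ∧ t (t c) = c) := by
  unfold LeadsTo at h hu
  push Not at h
  obtain ⟨i, hi, hia, hib, h1, h2⟩ := h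
  simp only [Set.mem_sdiff, Set.mem_insert_iff, Set.mem_singleton_iff, not_or] at *
  have e1 := hu i hi hia hib
  have e2 := ht i
  have e3 := ht (t i)
  have e4 := ht c
  have e5 := ht (t c)
  have e6 := hu (t c)
  have e7 := hu (t i)
  have e8 := hcard c (t c) (t (t c))
  have e9 := htu i
  have e10 := htu (t i)
  have e11 := htu (t c)
  have e12 := hcard c i (t i)
  have e13 := hcard c i (t c)
  grind

end Diversion

/-- The profiles at which `diversion` departs from TTC: agents outside `E` want their own
endowment, `a` and `b` want to swap, and the others' favourites (given by `p`) lead to `a`. -/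
def Diverts {n : ℕ} (E : Set (Fin n)) (a b : Fin n) (p : PrefRel n → Fin n)
    (Pr : Fin n → PrefRel n) : Prop :=
  (∀ k ∉ E, top (Pr k) Set.univ k) ∧ top (Pr a) E b ∧ top (Pr b) E a ∧
    LeadsTo E a b fun i => p (Pr i)

open Classical in
/-- The mechanism that coincides with `τ`, except that `b` is given its second choice (according
to `q`) instead of `a` at the profiles in `Diverts`. -/
noncomputable def diversion {n : ℕ} {D : Set (PrefRel n)} (E : Set (Fin n)) (a b : Fin n)
    (p q : PrefRel n → Fin n) (τ : Profile n (fun _ => D) → Fin n → Fin n) :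
    Profile n (fun _ => D) → Fin n → Fin n := fun P =>
  if Diverts E a b p P.1 then diverted a b (q (P.1 b)) (fun i => p (P.1 i)) else τ P

section Diversion

variable {n : ℕ} {D : Set (PrefRel n)} (hD : ∀ P ∈ D, IsStrictTotalOrder (Fin n) P)
  {E : Set (Fin n)} {a b : Fin n} (hab : a ≠ b) (ha : a ∈ E) (hb : b ∈ E)
  (hcard : ∀ i j l, i ∈ E \ {a, b} → j ∈ E \ {a, b} → l ∈ E \ {a, b} → i = j ∨ j = l ∨ i = l)
  {p q : PrefRel n → Fin n} (hp : ∀ R ∈ D, top R (E \ {b}) (p R))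
  (hq : ∀ R ∈ D, top R (E \ {a}) (q R)) (hqb : ∀ R ∈ D, top R E a → q R ≠ b)
  {τ : Profile n (fun _ => D) → Fin n → Fin n} (hτ : ∀ P, isTTC P.1 (τ P))

lemma diversion_pos {P : Profile n fun _ => D} (h : Diverts E a b p P.1) :
    diversion E a b p q τ P = diverted a b (q (P.1 b)) fun i => p (P.1 i) := if_pos h

lemma diversion_neg {P : Profile n fun _ => D} (h : ¬ Diverts E a b p P.1) :
    diversion E a b p q τ P = τ P := if_neg h

include hq hqb in
lemma Diverts.second {P : Profile n fun _ => D} (h : Diverts E a b p P.1) :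
    q (P.1 b) ∈ E ∧ q (P.1 b) ≠ a ∧ q (P.1 b) ≠ b :=
  ⟨(hq _ (P.2 b)).1.1, (hq _ (P.2 b)).1.2, hqb _ (P.2 b) h.2.2.1⟩

include hp hq hqb hτ in
lemma diversion_bijective (P : Profile n fun _ => D) :
    Function.Bijective (diversion E a b p q τ P) := by
  by_cases h : Diverts E a b p P.1
  · rw [diversion_pos h]
    exact Finite.injective_iff_bijective.1 <|
      diverted_injective (h.second hq hqb) (fun i => (hp _ (P.2 i)).1) h.2.2.2
  · rw [diversion_neg h]
    exact (hτ P).1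

include hab ha hb hp hq hqb hτ in
lemma diversion_ir : IR (diversion E a b p q τ) := by
  intro P i
  by_cases h : Diverts E a b p P.1
  · rw [diversion_pos h]
    by_cases hi : i ∈ E
    · have h1 : top (P.1 a) E b := h.2.1
      unfold diverted
      split_ifs with h2 h3 h4
      · subst h2
        exact h1.weak ha
      · subst h3
        exact (hq _ (P.2 i)).weak ⟨hb, hab.symm⟩
      · exact (hp _ (P.2 i)).weak ⟨hi, h3⟩
      · exact Or.inl rfl
    · exact Or.inl (diverted_of_notMem ha hb (h.second hq hqb).1 (hp _ (P.2 _)).1.1 hi)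
  · rw [diversion_neg h]
    exact (hτ P).ir i

include hD hab ha hb hcard hp hq hqb hτ in
lemma diversion_pareto : ParetoEff (diversion E a b p q τ) := by
  intro P y hy hyx
  by_cases h : Diverts E a b p P.1
  · rw [diversion_pos h] at hyx ⊢
    exact diverted_pareto (fun i => hD _ (P.2 i)) hab ha hb hcard h.1 h.2.1 (hq _ (P.2 b))
      (hqb _ (P.2 b) h.2.2.1) (fun i => hp _ (P.2 i)) h.2.2.2 hy hyx
  · rw [diversion_neg h] at hyx ⊢
    exact (hτ P).pareto (fun i => hD _ (P.2 i)) hy hyx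

include hD ha hb hp hq hτ in
lemma diversion_eq_ttc (P : Profile n fun _ => D) {i : Fin n} (hi : i ∉ E ∨ i = a) :
    diversion E a b p q τ P i = τ P i := by
  by_cases h : Diverts E a b p P.1
  · have hout := fun k hk => (hτ P).self_of_top (fun i => hD _ (P.2 i)) (h.1 k hk)
    rw [diversion_pos h]
    rcases hi with hi | rfl
    · rw [hout i hi]
      exact diverted_of_notMem ha hb (hq _ (P.2 b)).1.1 (hp _ (P.2 _)).1.1 hi
    · rw [((hτ P).swap_of_tops (fun i => hD _ (P.2 i)) hout h.2.1 h.2.2.1).1]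
      exact if_pos rfl
  · rw [diversion_neg h]

include hD hab ha hb hp hq hτ in
lemma diversion_sp_second {P Q : Profile n fun _ => D} (hPQ : ∀ j, j ≠ b → Q.1 j = P.1 j) :
    diversion E a b p q τ P b = diversion E a b p q τ Q b ∨
      P.1 b (diversion E a b p q τ P b) (diversion E a b p q τ Q b) := by
  by_cases hcond : (∀ k ∉ E, top (P.1 k) Set.univ k) ∧ top (P.1 a) E b ∧
      LeadsTo E a b fun i => p (P.1 i)
  · have key : ∀ R : Profile n fun _ => D, (∀ j, j ≠ b → R.1 j = P.1 j) →
        (top (R.1 b) E a ∧ diversion E a b p q τ R b = q (R.1 b)) ∨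
        (top (R.1 b) E (diversion E a b p q τ R b) ∧ diversion E a b p q τ R b ≠ a) := by
      intro R hR
      have hout : ∀ k ∉ E, top (R.1 k) Set.univ k := fun k hk => by
        rw [hR k (by rintro rfl; exact hk hb)]
        exact hcond.1 k hk
      have hRa : top (R.1 a) E b := by
        rw [hR a hab]
        exact hcond.2.1
      have hlead : LeadsTo E a b fun i => p (R.1 i) := fun i hi hia hib => by
        have h1 : p (P.1 i) ≠ b := (hp _ (P.2 i)).1.2
        simpa only [hR i hib, hR _ h1] using hcond.2.2 i hi hia hib
      by_cases h : top (R.1 b) E a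
      · refine Or.inl ⟨h, ?_⟩
        rw [diversion_pos ⟨hout, hRa, h, hlead⟩]
        simp [diverted, hab.symm]
      · refine Or.inr ?_
        rw [diversion_neg fun h' => h h'.2.2.1]
        have := (hτ R).top_of_leadsTo (fun i => hD _ (R.2 i))
          (fun k hk => (hτ R).self_of_top (fun i => hD _ (R.2 i)) (hout k hk)) hb hRa ha
          (fun i => hp _ (R.2 i)) hlead
        exact ⟨this, fun h' => h (h' ▸ this)⟩
    have hQ : diversion E a b p q τ Q b ∈ E \ {a} := by
      rcases key Q hPQ with h | h
      · rw [h.2]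
        exact (hq _ (Q.2 b)).1
      · exact ⟨h.1.1, h.2⟩
    rcases key P fun _ _ => rfl with h | h
    · rw [h.2]
      exact (hq _ (P.2 b)).weak hQ
    · exact h.1.weak hQ.1
  · have hP : ¬ Diverts E a b p P.1 := fun h => hcond ⟨h.1, h.2.1, h.2.2.2⟩
    have hQ : ¬ Diverts E a b p Q.1 := fun h => hcond ⟨fun k hk => by
        rw [← hPQ k (by rintro rfl; exact hk hb)]
        exact h.1 k hk, by
        rw [← hPQ a hab]
        exact h.2.1, fun i hi hia hib => by
        have h1 : p (Q.1 i) ≠ b := (hp _ (Q.2 i)).1.2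
        simpa only [← hPQ i hib, ← hPQ _ h1] using h.2.2.2 i hi hia hib⟩
    rw [diversion_neg hP, diversion_neg hQ]
    exact (hτ P).strategyproof (fun i => hD _ (P.2 i)) (hτ Q) b hPQ

include hD hcard hp hτ in
/-- If a change of the report of `c` leads out of `Diverts`, then `c` receives its favourite. -/
lemma ttc_favourite_of_not_diverts {P Q : Profile n fun _ => D} {c : Fin n}
    (hc : c ∈ E \ {a, b}) (hPQ : ∀ j, j ≠ c → P.1 j = Q.1 j) (hQ : Diverts E a b p Q.1)
    (hP : ¬ Diverts E a b p P.1) :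
    τ P c = p (P.1 c) ∧ p (P.1 c) ≠ a ∧
      (p (P.1 c) = c ∨ p (P.1 c) ≠ c ∧ p (P.1 (p (P.1 c))) = c) := by
  have hs : ∀ i, IsStrictTotalOrder (Fin n) (P.1 i) := fun i => hD _ (P.2 i)
  have hca : c ≠ a := fun h => hc.2 (Or.inl h)
  have hcb : c ≠ b := fun h => hc.2 (Or.inr h)
  have hout : ∀ k ∉ E, τ P k = k := fun k hk => (hτ P).self_of_top hs <| by
    rw [hPQ k (by rintro rfl; exact hk hc.1)]
    exact hQ.1 k hk
  have hPa : top (P.1 a) E b := hPQ a hca.symm ▸ hQ.2.1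
  have hPb : top (P.1 b) E a := hPQ b hcb.symm ▸ hQ.2.2.1
  have hPout : ∀ k ∉ E, top (P.1 k) Set.univ k := fun k hk => by
    rw [hPQ k (by rintro rfl; exact hk hc.1)]
    exact hQ.1 k hk
  obtain ⟨hza, hzb⟩ := (hτ P).swap_of_tops hs hout hPa hPb
  have hinj := (hτ P).1.injective
  have hmem : ∀ k ∈ E \ {a, b}, τ P k ∈ E \ {a, b} := by
    rintro k ⟨hk, hk'⟩
    rw [Set.mem_insert_iff, Set.mem_singleton_iff, not_or] at hk'
    refine ⟨by_contra fun h => h ((hinj (hout _ h)).symm ▸ hk), ?_⟩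
    rintro (h | h)
    exacts [hk'.2 (hinj (h.trans hzb.symm)), hk'.1 (hinj (h.trans hza.symm))]
  have hlead : ¬ LeadsTo E a b fun i => p (P.1 i) := fun h => hP ⟨hPout, hPa, hPb, h⟩
  have hcyc := LeadsTo.cycle_of_not hcard hc (t := fun i => p (P.1 i))
    (u := fun i => p (Q.1 i)) (fun i => (hp _ (P.2 i)).1)
    (fun i hi => by simp only [hPQ i hi]) hQ.2.2.2 hlead
  refine ⟨?_, hcyc⟩
  have hpc := hp _ (P.2 c)
  have hmemb : ∀ k ∈ E \ {a, b}, τ P k ∈ E \ {b} := fun k hk =>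
    ⟨(hmem k hk).1, fun h => (hmem k hk).2 (Or.inr h)⟩
  rcases hcyc.2 with h | ⟨hne, h⟩
  · refine hpc.eq_of_rel (hs c) (hmemb c hc) ?_
    rw [h]
    exact (hτ P).ir c
  · have hd : p (P.1 c) ∈ E \ {a, b} := ⟨hpc.1.1, by
      rintro (h' | h')
      exacts [hcyc.1 h', hpc.1.2 h']⟩
    have hpd := hp _ (P.2 (p (P.1 c)))
    generalize p (P.1 c) = d at *
    by_contra hzc
    have hzc' : τ P c = c := by
      rcases hcard _ _ _ (hmem c hc) hc hd with h' | h' | h'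
      exacts [h', absurd h'.symm hne, absurd h' hzc]
    have hzd : τ P d ≠ c := fun h' => hne (hinj (h'.trans hzc'.symm))
    have hzd' : τ P d = d := by
      rcases hcard _ _ _ (hmem d hd) hc hd with h' | h' | h'
      exacts [absurd h' hzd, absurd h'.symm hne, h']
    refine ParetoEff.pairEff (fun P => (hτ P).1) (fun P i e h => ?_)
      (fun P y hy hyx => (hτ P).pareto (fun i => hD _ (P.2 i)) hy hyx) P c d ⟨?_, ?_⟩
    · exact rel_asymm (hD _ (P.2 i)) h h
    · rw [hzc', hzd']
      exact hpc.2 c ⟨hc.1, hcb⟩ hne.symm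
    · rw [hzc', hzd']
      exact (h ▸ hpd).2 d ⟨hd.1, hpc.1.2⟩ hne

include hD hab ha hb hcard hp hq hqb hτ in
lemma diversion_sp : SP (diversion E a b p q τ) := by
  intro P Q c hPQ
  by_cases hc : c ∈ E \ {a, b}
  swap
  · by_cases hcb : c = b
    · subst hcb
      exact diversion_sp_second hD hab ha hb hp hq hτ hPQ
    · have hc' : c ∉ E ∨ c = a := by
        simp only [Set.mem_sdiff, Set.mem_insert_iff, Set.mem_singleton_iff] at hc
        tauto
      rw [diversion_eq_ttc hD ha hb hp hq hτ P hc', diversion_eq_ttc hD ha hb hp hq hτ Q hc']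
      exact (hτ P).strategyproof (fun i => hD _ (P.2 i)) (hτ Q) c hPQ
  have hca : c ≠ a := fun h => hc.2 (Or.inl h)
  have hcb : c ≠ b := fun h => hc.2 (Or.inr h)
  have hQP : ∀ j, j ≠ c → P.1 j = Q.1 j := fun j hj => (hPQ j hj).symm
  have hpc := hp _ (P.2 c)
  have hval : ∀ R : Profile n fun _ => D, Diverts E a b p R.1 →
      diversion E a b p q τ R c =
        if c = q (R.1 b) ∨ c = p (R.1 (q (R.1 b))) then p (R.1 c) else c := fun R hR => by
    rw [diversion_pos hR]
    simp only [diverted, hca, hcb, if_false]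
  have hvalmem : ∀ R : Profile n fun _ => D, Diverts E a b p R.1 →
      diversion E a b p q τ R c ∈ E \ {b} := fun R hR => by
    rw [hval R hR]
    split_ifs
    exacts [(hp _ (R.2 c)).1, ⟨hc.1, hcb⟩]
  have hb' : P.1 b = Q.1 b := hQP b hcb.symm
  have hon : (c = q (P.1 b) ∨ c = p (P.1 (q (P.1 b)))) ↔
      (c = q (Q.1 b) ∨ c = p (Q.1 (q (Q.1 b)))) := by
    rw [hb']
    refine or_congr_right' fun h => ?_
    rw [hQP _ (Ne.symm h)]
  by_cases hP : Diverts E a b p P.1 <;> by_cases hQ : Diverts E a b p Q.1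
  · by_cases h : c = q (P.1 b) ∨ c = p (P.1 (q (P.1 b)))
    · rw [hval P hP, if_pos h]
      exact hpc.weak (hvalmem Q hQ)
    · rw [hval P hP, hval Q hQ, if_neg h, if_neg (hon.not.1 h)]
      exact Or.inl rfl
  · obtain ⟨h1, h2, h3⟩ := ttc_favourite_of_not_diverts hD hcard hp hτ hc hPQ hP hQ
    rw [diversion_neg hQ, h1, hval P hP]
    split_ifs with h
    · exact hpc.weak (hp _ (Q.2 c)).1
    · refine Or.inl (Eq.symm (h3.resolve_right fun h4 => ?_))
      obtain ⟨hxE, hxa, hxb⟩ := hP.second hq hqb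
      have hd : p (Q.1 c) ∈ E \ {a, b} := ⟨(hp _ (Q.2 c)).1.1, by
        rintro (h' | h')
        exacts [h2 h', (hp _ (Q.2 c)).1.2 h']⟩
      have hx : q (P.1 b) = p (Q.1 c) := by
        rcases hcard _ _ _ hc hd ⟨hxE, by rintro (h' | h'); exacts [hxa h', hxb h']⟩ with
          h' | h' | h'
        exacts [absurd h'.symm h4.1, h'.symm, absurd (Or.inl h') h]
      refine h (Or.inr ?_)
      rw [hx, hQP _ h4.1]
      exact h4.2.symm
  · obtain ⟨h1, -⟩ := ttc_favourite_of_not_diverts hD hcard hp hτ hc hQP hQ hP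
    rw [diversion_neg hP, h1]
    exact hpc.weak (hvalmem Q hQ)
  · rw [diversion_neg hP, diversion_neg hQ]
    exact (hτ P).strategyproof (fun i => hD _ (P.2 i)) (hτ Q) c hPQ

end Diversion

/-- A violation of the top-two condition can be moved to a set of objects whose complement
consists of attainable favourites. -/
lemma exists_maximal_violation {α : Type*} [Finite α] {D : Set (α → α → Prop)}
    (hD : ∀ P ∈ D, IsStrictTotalOrder α P) (h : ¬ topTwo D) : ∃ (E : Set α) (a b : α), a ∈ E ∧ b ∈ E ∧ a ≠ b ∧ (∃ P ∈ D, top P E a) ∧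
      (∃ P ∈ D, top P E b) ∧ (∀ P ∈ D, top P E a → ¬ top P (E \ {a}) b) ∧
      ∀ k ∉ E, ∃ P ∈ D, top P (insert k E) k := by
  unfold topTwo at h
  push Not at h
  obtain ⟨E₀, -, a, b, ha, hb, hab, hPa, hPb, hno⟩ := h
  obtain ⟨E, -, ⟨ha, hb, hPa, hPb, hno⟩, hmax⟩ := (Set.toFinite {E : Set α | a ∈ E ∧ b ∈ E ∧
    (∃ P ∈ D, top P E a) ∧ (∃ P ∈ D, top P E b) ∧
    ∀ P ∈ D, top P E a → ¬ top P (E \ {a}) b}).exists_le_maximal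
      (a := E₀) ⟨ha, hb, hPa, hPb, hno⟩
  refine ⟨E, a, b, ha, hb, hab, hPa, hPb, hno, fun k hk => ?_⟩
  by_contra! hk'
  have hext : ∀ P ∈ D, ∀ c, top P E c → top P (insert k E) c := by
    intro P hP c hc
    obtain ⟨d, hd⟩ := exists_top (hD P hP) (Set.insert_nonempty k E)
    rcases Set.mem_insert_iff.1 hd.1 with rfl | hdE
    · exact absurd hd (hk' P hP)
    · have hdE' : top P E d := ⟨hdE, fun e he => hd.2 e (Set.mem_insert_of_mem k he)⟩
      exact hc.unique (hD P hP) hdE' ▸ hd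
  refine hk (hmax ⟨Set.mem_insert_of_mem k ha, Set.mem_insert_of_mem k hb, ?_, ?_, ?_⟩
    (Set.subset_insert k E) (Set.mem_insert k E))
  · obtain ⟨P, hP, h⟩ := hPa
    exact ⟨P, hP, hext P hP a h⟩
  · obtain ⟨P, hP, h⟩ := hPb
    exact ⟨P, hP, hext P hP b h⟩
  · intro P hP h1 h2
    exact hno P hP ⟨ha, fun c hc => h1.2 c (Set.mem_insert_of_mem k hc)⟩
      ⟨⟨hb, hab.symm⟩, fun c hc => h2.2 c ⟨Set.mem_insert_of_mem k hc.1, hc.2⟩⟩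

lemma not_five_distinct {n : ℕ} (hn : n ≤ 4) (i j k l m : Fin n) : ¬ [i, j, k, l, m].Nodup := by
  intro h
  have := h.length_le_card
  simp only [List.length_cons, List.length_nil, Fintype.card_fin] at this
  omega

/-- If the top-two condition fails, TTC is not the only individually rational, Pareto efficient and
strategyproof mechanism. -/
lemma exists_non_ttc {n : ℕ} (hn : n ≤ 4) {D : Set (PrefRel n)}
    (hD : ∀ P ∈ D, IsStrictTotalOrder (Fin n) P) (h : ¬ topTwo D) :
    ∃ φ : Profile n (fun _ => D) → Fin n → Fin n,
      ((∀ P, Function.Bijective (φ P)) ∧ IR φ ∧ ParetoEff φ ∧ SP φ) ∧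
        ∃ P, ¬ isTTC P.1 (φ P) := by
  classical
  obtain ⟨E, a, b, ha, hb, hab, ⟨Ra, hRa, hRa'⟩, ⟨Rb, hRb, hRb'⟩, hno, hk⟩ :=
    exists_maximal_violation hD h
  have hfav : ∀ S : Set (Fin n), S.Nonempty → ∀ R : PrefRel n, ∃ c, R ∈ D → top R S c := by
    intro S hS R
    by_cases hR : R ∈ D
    · exact (exists_top (hD R hR) hS).imp fun c hc _ => hc
    · exact ⟨a, fun h => absurd h hR⟩
  choose p hp using hfav (E \ {b}) ⟨a, ha, hab⟩
  choose q hq using hfav (E \ {a}) ⟨b, hb, hab.symm⟩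
  choose τ hτ using fun P : Profile n fun _ => D => exists_ttc P.1 fun i => hD _ (P.2 i)
  have hqb : ∀ R ∈ D, top R E a → q R ≠ b := fun R hR hRa h => hno R hR hRa (h ▸ hq R hR)
  have hcard : ∀ i j l, i ∈ E \ {a, b} → j ∈ E \ {a, b} → l ∈ E \ {a, b} →
      i = j ∨ j = l ∨ i = l := by
    intro i j l hi hj hl
    have := not_five_distinct hn i j l a b
    simp only [Set.mem_sdiff, Set.mem_insert_iff, Set.mem_singleton_iff] at hi hj hl
    simp only [List.nodup_cons, List.mem_cons, List.not_mem_nil] at this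
    grind
  refine ⟨diversion E a b p q τ, ⟨diversion_bijective hp hq hqb hτ,
    diversion_ir hab ha hb hp hq hqb hτ, diversion_pareto hD hab ha hb hcard hp hq hqb hτ,
    diversion_sp hD hab ha hb hcard hp hq hqb hτ⟩, ?_⟩
  have hqa := (hq Ra hRa).1
  have huniv : ∀ k ∉ E, insert k E = Set.univ := by
    intro k hkE
    refine Set.eq_univ_of_forall fun m => ?_
    by_contra hm
    have h1 := hqb Ra hRa hRa'
    have h2 := not_five_distinct hn a b (q Ra) k m
    simp only [Set.mem_sdiff, Set.mem_insert_iff, Set.mem_singleton_iff] at hqa hm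
    simp only [List.nodup_cons, List.mem_cons, List.not_mem_nil] at h2
    grind
  choose! S hS hStop using hk
  let P : Profile n fun _ => D :=
    ⟨fun i => if i ∉ E then S i else if i = a then Rb else Ra, fun i => by
      dsimp only
      split_ifs with h1 h2
      exacts [hRb, hRa, hS i h1]⟩
  have hPout : ∀ k ∉ E, P.1 k = S k := fun k hk => if_pos hk
  have hPa : P.1 a = Rb := by simp [P, ha]
  have hPin : ∀ i ∈ E, i ≠ a → P.1 i = Ra := fun i hi hia => by simp [P, hi, hia]
  have hPb := hPin b hb hab.symm
  have hout : ∀ k ∉ E, top (P.1 k) Set.univ k := fun k hk => by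
    rw [hPout k hk, ← huniv k hk]
    exact hStop k hk
  have hdiv : Diverts E a b p P.1 := by
    refine ⟨hout, hPa ▸ hRb', hPb ▸ hRa', fun i hi hia _ => Or.inl ?_⟩
    dsimp only
    rw [hPin i hi hia]
    exact (hp Ra hRa).unique (hD Ra hRa) ⟨⟨ha, hab⟩, fun c hc => hRa'.2 c hc.1⟩
  refine ⟨P, fun hT => hqa.2 ?_⟩
  have hs : ∀ i, IsStrictTotalOrder (Fin n) (P.1 i) := fun i => hD _ (P.2 i)
  have hswap := (hT.swap_of_tops hs (fun k hk => hT.self_of_top hs (hout k hk)) hdiv.2.1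
    hdiv.2.2.1).2
  rw [diversion_pos hdiv, hPb] at hswap
  simpa [diverted, hab.symm] using hswap

/-- for n ≤ 4, the top-two condition holds iff TTC is the unique
individually rational, Pareto efficient, strategyproof mechanism, iff TTC is the
unique individually rational, pair efficient, strategyproof mechanism. -/
theorem stmt18 {n : ℕ} (hn : n ≤ 4) (D : Set (PrefRel n))
    (hD : ∀ P ∈ D, IsStrictTotalOrder (Fin n) P) :
    List.TFAE
      [ topTwo D,
        ∀ φ : Profile n (fun _ => D) → Fin n → Fin n,
          ((∀ P, Function.Bijective (φ P)) ∧ IR φ ∧ ParetoEff φ ∧ SP φ) ↔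
            (∀ P, isTTC P.1 (φ P)),
        ∀ φ : Profile n (fun _ => D) → Fin n → Fin n,
          ((∀ P, Function.Bijective (φ P)) ∧ IR φ ∧ PairEff φ ∧ SP φ) ↔
            (∀ P, isTTC P.1 (φ P)) ] := by
  have hax : ∀ φ : Profile n (fun _ => D) → Fin n → Fin n, (∀ P, isTTC P.1 (φ P)) →
      (∀ P, Function.Bijective (φ P)) ∧ IR φ ∧ ParetoEff φ ∧ SP φ := fun φ hφ =>
    ⟨fun P => (hφ P).1, fun P i => (hφ P).ir i,
      fun P y hy hyx => (hφ P).pareto (fun i => hD _ (P.2 i)) hy hyx,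
      fun P Q i hPQ => (hφ P).strategyproof (fun i => hD _ (P.2 i)) (hφ Q) i hPQ⟩
  have hpair : ∀ φ : Profile n (fun _ => D) → Fin n → Fin n,
      (∀ P, Function.Bijective (φ P)) → ParetoEff φ → PairEff φ := fun φ hφ h =>
    h.pairEff hφ fun P i a h' => rel_asymm (hD _ (P.2 i)) h' h'
  tfae_have 1 → 3 := by
    intro htt φ
    refine ⟨fun ⟨hbij, hir, hpe, hsp⟩ P => ?_, fun hφ => ?_⟩
    · obtain ⟨x, hx⟩ := exists_ttc P.1 fun i => hD _ (P.2 i)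
      rwa [eq_ttc_of_topTwo hD htt hbij hir hpe hsp hx]
    · obtain ⟨hbij, hir, hpe, hsp⟩ := hax φ hφ
      exact ⟨hbij, hir, hpair φ hbij hpe, hsp⟩
  tfae_have 3 → 2 := fun h φ =>
    ⟨fun ⟨hbij, hir, hpe, hsp⟩ => (h φ).1 ⟨hbij, hir, hpair φ hbij hpe, hsp⟩, hax φ⟩
  tfae_have 2 → 1 := by
    intro h
    by_contra htt
    obtain ⟨φ, hφ, P, hP⟩ := exists_non_ttc hn hD htt
    exact hP ((h φ).1 hφ P)
  tfae_finish
end
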